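/- arXiv:0908.1782 — 9 statements merged into one kernel-verified Lean document; each statement's English description precedes it below -/
import Mathlib

section
/- Let τ be an admissible τ-function of length N ≥ 2 with τ(N) > 0, and let l_0' = N and l_1' > ⋯ > l_k' be the markers of τ appearing in the orbit of N, with l_i = τ(l_i'). Then each l_i lies in the forward orbit {τ^m(N) : m ≥ 1} of N, the values satisfy the strict inequalities τ(N) = l_0 > l_1 > ⋯ > l_k ≥ 0, and for each 0 ≤ i < k there exists an integer n_i ≥ 1 with τ^{n_i}(l_i) = l_{i+1}. -/
open Function

/-- The order of `n` under `τ`: the least `m` with `τ^[m] n = 0` (junk value `0` if none). -/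
noncomputable def ordOf (τ : ℕ → ℕ) (n : ℕ) : ℕ := sInf {m | τ^[m] n = 0}

/-- Property (A): `τ(1) = 0`. -/
def PropA (τ : ℕ → ℕ) : Prop := τ 1 = 0

/-- Property (B): `τ(n+1) ≤ τ(n) + 1` for all `1 ≤ n ≤ N - 1`. -/
def PropB (N : ℕ) (τ : ℕ → ℕ) : Prop :=
  ∀ n, 1 ≤ n → n + 1 ≤ N → τ (n + 1) ≤ τ n + 1

/-- Property (C): if `τ(n+1) < τ^k(n) + 1` for some `0 < k < ord(n)`, then
`τ(n+1) ≤ τ^{k+1}(n) + 1`. -/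
def PropC (N : ℕ) (τ : ℕ → ℕ) : Prop :=
  ∀ n, 1 ≤ n → n + 1 ≤ N → ∀ k, 0 < k → k < ordOf τ n →
    τ (n + 1) < τ^[k] n + 1 → τ (n + 1) ≤ τ^[k + 1] n + 1

/-- Property (D): if `τ(n+1) < τ^k(n) + 1` for some `0 < k < ord(n)`, and
`τ(τ^k(n)+1) = τ^{k+1}(n)+1`, then `τ(n+1) < τ^{k+1}(n) + 1`. -/
def PropD (N : ℕ) (τ : ℕ → ℕ) : Prop :=
  ∀ n, 1 ≤ n → n + 1 ≤ N → ∀ k, 0 < k → k < ordOf τ n →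
    τ (n + 1) < τ^[k] n + 1 → τ (τ^[k] n + 1) = τ^[k + 1] n + 1 →
      τ (n + 1) < τ^[k + 1] n + 1

/-- Property (E): if `ord(n) > 1` and `ord(τ^{ord(n)-1}(n) + 1) = 1`, then `τ(n+1) ≠ 0`. -/
def PropE (N : ℕ) (τ : ℕ → ℕ) : Prop :=
  ∀ n, 1 ≤ n → n + 1 ≤ N → 1 < ordOf τ n →
    ordOf τ (τ^[ordOf τ n - 1] n + 1) = 1 → τ (n + 1) ≠ 0

/-- An admissible τ-function of length `N`, encoded as a function `ℕ → ℕ` with the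
convention `τ 0 = 0`, satisfying properties (A)–(E) on the domain `{1, …, N}`. -/
def Admissible (N : ℕ) (τ : ℕ → ℕ) : Prop :=
  τ 0 = 0 ∧ PropA τ ∧ PropB N τ ∧ PropC N τ ∧ PropD N τ ∧ PropE N τ

/-- An admissible τ-function of length `N`, normalized to vanish outside `{1, …, N}`
so that τ-functions of length `N` correspond bijectively to such `ℕ → ℕ`. -/
def TauFunction (N : ℕ) (τ : ℕ → ℕ) : Prop :=
  Admissible N τ ∧ ∀ n, N < n → τ n = 0

/-- `m` is a marker of a τ-function of length `N`: `m ∈ {1, …, N-1}` and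
`τ(m+1) < τ(m) + 1`. -/
def IsMarker (N : ℕ) (τ : ℕ → ℕ) (m : ℕ) : Prop :=
  1 ≤ m ∧ m + 1 ≤ N ∧ τ (m + 1) < τ m + 1

/-- `m` is a marker of `τ` appearing in the orbit `N ↦ τ(N) ↦ τ²(N) ↦ ⋯`. -/
def IsMarkerInOrbit (N : ℕ) (τ : ℕ → ℕ) (m : ℕ) : Prop :=
  IsMarker N τ m ∧ ∃ j, 1 ≤ j ∧ τ^[j] N = m

/-- `l` is a marked level of `τ`: `l = τ^n(m)` for some marker `m` and `n > 0`,
with `0` always marked. -/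
def IsMarkedLevel (N : ℕ) (τ : ℕ → ℕ) (l : ℕ) : Prop :=
  l = 0 ∨ ∃ m, IsMarker N τ m ∧ ∃ j, 0 < j ∧ τ^[j] m = l

/-- A marked grid of size `N`: entries `M j k` for `j + k ≤ N` satisfying the
Branner–Hubbard tableau rules (M0)–(M4). -/
def MarkedGrid (N : ℕ) (M : ℕ → ℕ → Prop) : Prop :=
  -- (M0)
  (∀ n, n ≤ N → M n 0 ∧ M 0 n) ∧
  -- (M1)
  (∀ j k, j + k ≤ N → M j k → ∀ l, l ≤ j → M l k) ∧
  -- (M2)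
  (∀ j k, j + k ≤ N → M j k → ∀ i, i ≤ j → (M (j - i) (k + i) ↔ M (j - i) i)) ∧
  -- (M3)
  (∀ j k m, j + k < N → 1 ≤ m → m ≤ j → M j k → ¬ M (j + 1) k →
    (∀ i, 0 < i → i < m → ¬ M (j - i) i) → M (j - m + 1) m → ¬ M (j - m + 1) (k + m)) ∧
  -- (M4)
  (∀ j k, j + k < N → M j k → ¬ M 1 j → M (j + 1) k →
    (∀ i, 0 < i → i < j → ¬ M (j - i) (k + i)) → ¬ M 1 (j + k))


/-- for an admissible τ-function of length `N ≥ 2` with `τ(N) > 0`,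
letting `l'₀ = N > l'₁ > ⋯ > l'ₖ` enumerate the markers in the orbit of `N`, and
`lᵢ = τ(l'ᵢ)`: each `lᵢ` lies in the forward orbit of `N`, the `lᵢ` are strictly
decreasing (so `τ(N) = l₀ > l₁ > ⋯ > lₖ ≥ 0`), and for each `0 ≤ i < k` there is
`nᵢ ≥ 1` with `τ^[nᵢ](lᵢ) = l_{i+1}`. -/
theorem marker_levels_structure (N k : ℕ) (hN : 2 ≤ N) (τ : ℕ → ℕ)
    (hadm : Admissible N τ) (hτN : 0 < τ N)
    (l' : Fin (k + 1) → ℕ) (hl0 : l' 0 = N) (hanti : StrictAnti l')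
    (henum : ∀ m, IsMarkerInOrbit N τ m ↔ ∃ i : Fin (k + 1), i ≠ 0 ∧ l' i = m) :
    (∀ i : Fin (k + 1), ∃ m, 1 ≤ m ∧ τ^[m] N = τ (l' i)) ∧
    StrictAnti (fun i : Fin (k + 1) => τ (l' i)) ∧
    (∀ i : Fin k, ∃ n, 1 ≤ n ∧ τ^[n] (τ (l' i.castSucc)) = τ (l' i.succ)) := by
  obtain ⟨h0, hA, hB, -⟩ := hadm
  have hlt : ∀ n, 1 ≤ n → n ≤ N → τ n < n := by
    intro n hn
    induction n, hn using Nat.le_induction with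
    | base => intro _; rw [hA]; omega
    | succ n hn ih =>
      intro h
      have h1 := ih (by omega)
      have h2 := hB n hn h
      omega
  have hle : ∀ n, n ≤ N → τ n ≤ n := by
    intro n hn
    rcases Nat.eq_zero_or_pos n with h | h
    · subst h; omega
    · exact (hlt n h hn).le
  have hit : ∀ d n, n ≤ N → τ^[d] n ≤ n := by
    intro d
    induction d with
    | zero => intro n _; simp
    | succ d ih =>
      intro n hn
      rw [iterate_succ_apply]
      have h1 := hle n hn
      have h2 := ih (τ n) (by omega)
      omega
  have horb : ∀ i : Fin (k + 1), ∃ j, τ^[j] N = l' i := by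
    intro i
    by_cases hi : i = 0
    · exact ⟨0, by simp [hi, hl0]⟩
    · obtain ⟨-, j, -, hj⟩ := (henum (l' i)).2 ⟨i, hi, rfl⟩
      exact ⟨j, hj⟩
  have hpos : ∀ i : Fin (k + 1), 1 ≤ l' i := by
    intro i
    by_cases hi : i = 0
    · rw [hi, hl0]; omega
    · exact ((henum (l' i)).2 ⟨i, hi, rfl⟩).1.1
  have hleN : ∀ i : Fin (k + 1), l' i ≤ N := by
    intro i
    rw [← hl0]
    exact hanti.antitone (Fin.zero_le i)
  have key : ∀ a b : Fin (k + 1), a < b → ∃ d, τ^[d] (τ (l' a)) = l' b := by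
    intro a b hab
    obtain ⟨ja, hja⟩ := horb a
    obtain ⟨jb, hjb⟩ := horb b
    have hl := hanti hab
    have hj : ja < jb := by
      by_contra hcon
      obtain ⟨e, rfl⟩ := Nat.exists_eq_add_of_le (Nat.le_of_not_lt hcon)
      have h := hit e (l' b) (hleN b)
      rw [← hjb, ← iterate_add_apply, Nat.add_comm e jb, hja, hjb] at h
      omega
    obtain ⟨e, rfl⟩ := Nat.exists_eq_add_of_lt hj
    refine ⟨e, ?_⟩
    rw [← iterate_succ_apply, ← hja, ← iterate_add_apply, ← hjb]
    have he : e.succ + ja = ja + e + 1 := by omega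
    rw [he]
  refine ⟨?_, ?_, ?_⟩
  · intro i
    obtain ⟨j, hj⟩ := horb i
    exact ⟨j + 1, by omega, by rw [iterate_succ_apply', hj]⟩
  · intro a b hab
    obtain ⟨d, hd⟩ := key a b hab
    have h1 := hlt _ (hpos b) (hleN b)
    have h2 := hit d (τ (l' a)) ((hle _ (hleN a)).trans (hleN a))
    show τ (l' b) < τ (l' a)
    omega
  · intro i
    obtain ⟨d, hd⟩ := key i.castSucc i.succ Fin.castSucc_lt_succ
    exact ⟨d + 1, by omega, by rw [iterate_succ_apply', hd]⟩
end

section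
/- Let N be a positive integer and let τ: {1,…,N} → ℕ∪{0} be a τ-function satisfying properties (A)–(E). Define the array M_τ(j,k) ∈ {0,1} for j,k ≥ 0 with j+k ≤ N by M_τ(j,k) = 1 if and only if j = k = 0 or j = τ^m(j+k) for some m ≥ 0. Then M_τ is a marked grid of size N, i.e., it satisfies tableau rules (M0), (M1), (M2), (M3), and (M4). -/
open Function

def Orb (τ : ℕ → ℕ) (n j : ℕ) : Prop := ∃ m : ℕ, τ^[m] n = j

theorem Orb.refl' (τ : ℕ → ℕ) (n : ℕ) : Orb τ n n := ⟨0, rfl⟩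

theorem Orb.trans' {τ : ℕ → ℕ} {a b c : ℕ} (h : Orb τ a b) (h' : Orb τ b c) : Orb τ a c := by
  obtain ⟨m, rfl⟩ := h
  obtain ⟨l, rfl⟩ := h'
  exact ⟨l + m, by rw [Function.iterate_add_apply]⟩

theorem Orb.step' {τ : ℕ → ℕ} {n j : ℕ} (h : Orb τ (τ n) j) : Orb τ n j :=
  Orb.trans' ⟨1, rfl⟩ h

theorem Orb.cases' {τ : ℕ → ℕ} {n j : ℕ} (h : Orb τ n j) : j = n ∨ Orb τ (τ n) j := by
  obtain ⟨m, rfl⟩ := h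
  cases m with
  | zero => left; rfl
  | succ m => right; exact ⟨m, by rw [Function.iterate_succ_apply]⟩

theorem tau_lt {N : ℕ} {τ : ℕ → ℕ} (h : Admissible N τ) (n : ℕ) (hn : n + 1 ≤ N) :
    τ (n + 1) < n + 1 := by
  induction n with
  | zero => have := h.2.1; unfold PropA at this; simp [this]
  | succ n ih => have := h.2.2.1 (n + 1) (by omega) hn; have := ih (by omega); omega

theorem Orb.le' {N : ℕ} {τ : ℕ → ℕ} (h : Admissible N τ) (n j : ℕ) (hn : n ≤ N)
    (ho : Orb τ n j) : j ≤ n := by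
  induction n using Nat.strong_induction_on with
  | _ n ih =>
    rcases ho.cases' with rfl | h1
    · exact le_rfl
    · cases n with
      | zero =>
        obtain ⟨m, rfl⟩ := ho
        rw [Function.iterate_fixed h.1]
      | succ n =>
        have := tau_lt h n hn
        have := ih _ this (by omega) h1
        omega

theorem Orb.zero' {N : ℕ} {τ : ℕ → ℕ} (h : Admissible N τ) (n : ℕ) (hn : n ≤ N) :
    Orb τ n 0 := by
  induction n using Nat.strong_induction_on with
  | _ n ih =>
    cases n with
    | zero => exact Orb.refl' _ _
    | succ n =>
      have := tau_lt h n hn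
      exact (ih _ this (by omega)).step'

theorem Orb.tri' {N : ℕ} {τ : ℕ → ℕ} (h : Admissible N τ) (n a b : ℕ) (hn : n ≤ N)
    (ha : Orb τ n a) (hb : Orb τ n b) (hab : b ≤ a) : Orb τ a b := by
  have key : Orb τ a b ∨ Orb τ b a := by
    obtain ⟨m, rfl⟩ := ha
    obtain ⟨l, rfl⟩ := hb
    rcases le_total m l with hml | hml
    · left; exact ⟨l - m, by rw [← Function.iterate_add_apply]; congr 2; omega⟩
    · right; exact ⟨m - l, by rw [← Function.iterate_add_apply]; congr 2; omega⟩
  rcases key with h1 | h1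
  · exact h1
  · have := Orb.le' h _ _ hn hb
    have := Orb.le' h b a (by omega) h1
    have : a = b := by omega
    subst this
    exact Orb.refl' _ _

theorem lt_ordOf {N : ℕ} {τ : ℕ → ℕ} (h : Admissible N τ) (n k : ℕ) (hn : n ≤ N)
    (hk : τ^[k] n ≠ 0) : k < ordOf τ n := by
  have hne : {m | τ^[m] n = 0}.Nonempty := Orb.zero' h n hn
  have hm : τ^[ordOf τ n] n = 0 := Nat.sInf_mem hne
  by_contra hc
  apply hk
  have : k = (k - ordOf τ n) + ordOf τ n := by omega
  rw [this, Function.iterate_add_apply, hm, Function.iterate_fixed h.1]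

theorem tau_succ {N : ℕ} {τ : ℕ → ℕ} (h : Admissible N τ) (n : ℕ) (hn : n + 1 ≤ N) :
    τ (n + 1) = 0 ∨ ∃ p, Orb τ n p ∧ τ (n + 1) = p + 1 := by
  rcases Nat.eq_zero_or_pos n with rfl | hpos
  · left; exact h.2.1
  by_contra hc
  push Not at hc
  obtain ⟨h0, hc⟩ := hc
  have key : ∀ k, τ (n + 1) ≤ τ^[k + 1] n + 1 := by
    intro k
    induction k with
    | zero => exact h.2.2.1 n hpos hn
    | succ k ih =>
      have hne := hc (τ^[k + 1] n) ⟨k + 1, rfl⟩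
      by_cases hz : τ^[k + 1] n = 0
      · omega
      · exact h.2.2.2.1 n hpos hn (k + 1) (by omega) (lt_ordOf h n _ (by omega) hz) (by omega)
  obtain ⟨m, hm⟩ := Orb.zero' h n (by omega)
  have h1 := key m
  rw [Function.iterate_succ_apply', hm, h.1] at h1
  exact hc 0 ⟨m, hm⟩ (by omega)

theorem Orb.pred' {N : ℕ} {τ : ℕ → ℕ} (h : Admissible N τ) (n j : ℕ) (hn : n + 1 ≤ N)
    (ho : Orb τ (n + 1) (j + 1)) : Orb τ n j := by
  induction n using Nat.strong_induction_on with
  | _ n ih =>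
    rcases ho.cases' with h1 | h1
    · have : j = n := by omega
      subst this; exact Orb.refl' _ _
    · have hlt := tau_lt h n hn
      rcases tau_succ h n hn with h2 | ⟨p, hp, h2⟩
      · rw [h2] at h1
        have := Orb.le' h 0 _ (by omega) h1
        omega
      · rw [h2] at h1
        exact hp.trans' (ih p (by omega) (by omega) h1)

theorem Orb.m3' {N : ℕ} {τ : ℕ → ℕ} (h : Admissible N τ) (n j : ℕ) (hn : n + 1 ≤ N)
    (hj : 1 ≤ j) (ho : Orb τ n j) (hno : ¬ Orb τ (n + 1) (j + 1))
    (ht : τ (j + 1) = τ j + 1) : ¬ Orb τ (n + 1) (τ j + 1) := by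
  induction n using Nat.strong_induction_on with
  | _ n ih =>
    intro hc
    have hjn := Orb.le' h n j (by omega) ho
    have hlt := tau_lt h n hn
    have htj : τ j < j := by
      have := tau_lt h (j - 1) (by omega)
      rwa [show j - 1 + 1 = j by omega] at this
    rcases hc.cases' with h1 | h1
    · omega
    have hle := Orb.le' h _ _ (by omega) h1
    by_cases hlt2 : τ (n + 1) < j + 1
    · obtain ⟨a, ha⟩ := ho
      have ha0 : 0 < a := by
        rcases Nat.eq_zero_or_pos a with rfl | h'
        · exfalso; apply hno
          have : n = j := ha
          subst this; exact Orb.refl' _ _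
        · exact h'
      have hD := h.2.2.2.2.1 n (by omega) hn a ha0 (lt_ordOf h n a (by omega) (by omega))
      rw [Function.iterate_succ_apply', ha] at hD
      have := hD hlt2 ht
      omega
    · rcases tau_succ h n hn with h2 | ⟨p, hp, h2⟩
      · omega
      · rw [h2] at h1
        have hpj : Orb τ p j := Orb.tri' h n p j (by omega) hp ho (by omega)
        refine ih p (by omega) (by omega) hpj ?_ h1
        intro h3
        apply hno
        apply Orb.step'
        rw [h2]; exact h3

/-- the array associated to an admissible τ-function of length `N`,
given by `M(j,k) = 1` iff `j = k = 0` or `j = τ^m(j+k)` for some `m ≥ 0`,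
is a marked grid of size `N`. -/
theorem tau_gives_markedGrid (N : ℕ) (hN : 1 ≤ N) (τ : ℕ → ℕ)
    (hadm : Admissible N τ) :
    MarkedGrid N (fun j k => (j = 0 ∧ k = 0) ∨ ∃ m : ℕ, τ^[m] (j + k) = j) := by
  have hM : ∀ j k, ((j = 0 ∧ k = 0) ∨ ∃ m : ℕ, τ^[m] (j + k) = j) ↔ Orb τ (j + k) j := by
    intro j k
    constructor
    · rintro (⟨rfl, rfl⟩ | h)
      · exact Orb.refl' _ _
      · exact h
    · intro h; right; exact h
  simp only [hM]
  have h := hadm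
  have hM2 : ∀ j k, j + k ≤ N → Orb τ (j + k) j → ∀ i, i ≤ j →
      (Orb τ (j - i + (k + i)) (j - i) ↔ Orb τ (j - i + i) (j - i)) := by
    intro j k hjk ho i hi
    rw [show j - i + (k + i) = j + k by omega, show j - i + i = j by omega]
    constructor
    · intro h1; exact Orb.tri' h _ _ _ hjk ho h1 (by omega)
    · intro h1; exact ho.trans' h1
  refine ⟨?_, ?_, hM2, ?_, ?_⟩
  · intro n hn
    exact ⟨Orb.refl' _ _, Orb.zero' h _ (by omega)⟩
  · intro j k hjk ho l hl
    induction j with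
    | zero =>
      have : l = 0 := by omega
      subst this; exact ho
    | succ j ih =>
      rcases Nat.lt_or_ge l (j + 1) with h1 | h1
      · apply ih (by omega) _ (by omega)
        apply Orb.pred' h _ _ (by omega)
        rwa [show j + k + 1 = j + 1 + k by omega]
      · have : l = j + 1 := by omega
        subst this; exact ho
  · intro j k m hjk hm hmj ho hno hi hm1
    beta_reduce at *
    rw [show j - m + 1 + m = j + 1 by omega] at hm1
    rw [show j - m + 1 + (k + m) = j + k + 1 by omega]
    rw [show j + 1 + k = j + k + 1 by omega] at hno
    have h1 := Orb.pred' h _ _ (by omega) hm1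
    have htj : τ j < j := by
      have := tau_lt h (j - 1) (by omega)
      rwa [show j - 1 + 1 = j by omega] at this
    have htm : τ j = j - m := by
      rcases h1.cases' with h2 | h2
      · omega
      have := Orb.le' h _ _ (by omega) h2
      by_contra hc
      apply hi (j - τ j) (by omega) (by omega)
      rw [show j - (j - τ j) = τ j by omega, show τ j + (j - τ j) = j by omega]
      exact ⟨1, rfl⟩
    have ht : τ (j + 1) = τ j + 1 := by
      have hb := h.2.2.1 j (by omega) (by omega)
      rcases hm1.cases' with h2 | h2
      · omega
      have := tau_lt h j (by omega)
      have := Orb.le' h _ _ (by omega) h2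
      omega
    rw [← htm]
    exact Orb.m3' h _ _ (by omega) (by omega) ho hno ht
  · intro j k hjk ho h1 h2 _ h3
    beta_reduce at *
    apply h1
    rw [show 1 + (j + k) = j + 1 + k by omega] at h3
    rw [show 1 + j = j + 1 by omega]
    exact Orb.tri' h _ _ _ (by omega) h2 h3 (by omega)
end

section
/- Let τ be an admissible τ-function of length N, with l_0' = N, markers l_1' > ⋯ > l_k' appearing in the orbit of N, and l_i = τ(l_i'). Let τ' : {1,…,N+1} → ℕ∪{0} be any extension of τ (i.e., τ'(n) = τ(n) for 1 ≤ n ≤ N). Then τ' is admissible if and only if either τ'(N+1) = l_i + 1 for some 0 ≤ i ≤ k, or τ'(N+1) = 0 and (l_k > 0 or k = 0). -/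
open Function

theorem aux_lt {N : ℕ} {τ : ℕ → ℕ} (h : Admissible N τ) : ∀ n, 1 ≤ n → n ≤ N → τ n < n := by
  obtain ⟨_, hA, hB, _⟩ := h
  intro n h1
  induction n, h1 using Nat.le_induction with
  | base => intro _; unfold PropA at hA; omega
  | succ n hn ih =>
    intro h2
    have := hB n hn h2
    have := ih (by omega)
    omega

theorem aux_iter_le {N : ℕ} {τ : ℕ → ℕ} (h : Admissible N τ) (n : ℕ) (hn : n ≤ N) (j : ℕ) :
    τ^[j] n ≤ n - j := by
  induction j with
  | zero => simp
  | succ j ih =>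
    rw [Function.iterate_succ_apply']
    rcases Nat.eq_zero_or_pos (τ^[j] n) with h0 | h0
    · rw [h0, h.1]; omega
    · have := aux_lt h _ h0 (by omega)
      omega

theorem aux_iter_eq {N : ℕ} {τ τ' : ℕ → ℕ} (h : Admissible N τ) (h0' : τ' 0 = 0)
    (hext : ∀ n, 1 ≤ n → n ≤ N → τ' n = τ n) (n : ℕ) (hn : n ≤ N) (j : ℕ) :
    τ'^[j] n = τ^[j] n := by
  induction j with
  | zero => simp
  | succ j ih =>
    rw [Function.iterate_succ_apply', Function.iterate_succ_apply', ih]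
    rcases Nat.eq_zero_or_pos (τ^[j] n) with h0 | h0
    · rw [h0, h.1, h0']
    · have := aux_iter_le h n hn j
      exact hext _ h0 (by omega)

theorem aux_ord_eq {N : ℕ} {τ τ' : ℕ → ℕ} (h : Admissible N τ) (h0' : τ' 0 = 0)
    (hext : ∀ n, 1 ≤ n → n ≤ N → τ' n = τ n) (n : ℕ) (hn : n ≤ N) :
    ordOf τ' n = ordOf τ n := by
  unfold ordOf
  simp only [aux_iter_eq h h0' hext n hn]

theorem aux_ord_one (τ : ℕ → ℕ) (m : ℕ) (hm : 1 ≤ m) : ordOf τ m = 1 ↔ τ m = 0 := by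
  unfold ordOf
  constructor
  · intro h
    have hne : {j | τ^[j] m = 0}.Nonempty := by
      apply Nat.nonempty_of_pos_sInf; omega
    have := Nat.sInf_mem hne
    rw [h] at this
    simpa using this
  · intro h
    have h1 : (1 : ℕ) ∈ {j | τ^[j] m = 0} := by simpa using h
    have h2 := Nat.sInf_le h1
    have h3 := Nat.sInf_mem ⟨1, h1⟩
    rcases Nat.eq_zero_or_pos (sInf {j | τ^[j] m = 0}) with h4 | h4
    · rw [h4] at h3
      simp at h3
      omega
    · omega

theorem aux_ord_spec {N : ℕ} {τ : ℕ → ℕ} (h : Admissible N τ) (n : ℕ) (h1 : 1 ≤ n) (hn : n ≤ N) :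
    1 ≤ ordOf τ n ∧ τ^[ordOf τ n] n = 0 ∧ ∀ j, j < ordOf τ n → 0 < τ^[j] n := by
  have hne : {j | τ^[j] n = 0}.Nonempty := ⟨n, by
    have := aux_iter_le h n hn n
    simp only [Set.mem_ofPred_eq]; omega⟩
  have hm : τ^[ordOf τ n] n = 0 := Nat.sInf_mem hne
  refine ⟨?_, hm, ?_⟩
  · rcases Nat.eq_zero_or_pos (ordOf τ n) with h4 | h4
    · rw [h4] at hm; simp at hm; omega
    · exact h4
  · intro j hj
    have := Nat.notMem_of_lt_sInf hj
    simp only [Set.mem_ofPred_eq] at this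
    omega

theorem aux_step {N : ℕ} (hN : 1 ≤ N) {τ τ' : ℕ → ℕ} (h : Admissible N τ) (h0' : τ' 0 = 0)
    (hext : ∀ n, 1 ≤ n → n ≤ N → τ' n = τ n) :
    Admissible (N + 1) τ' ↔
      (τ' (N + 1) ≤ τ N + 1 ∧
       (∀ j, 0 < j → j < ordOf τ N → τ' (N + 1) < τ^[j] N + 1 → τ' (N + 1) ≤ τ^[j + 1] N + 1) ∧
       (∀ j, 0 < j → j < ordOf τ N → τ' (N + 1) < τ^[j] N + 1 →
          τ (τ^[j] N + 1) = τ^[j + 1] N + 1 → τ' (N + 1) < τ^[j + 1] N + 1) ∧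
       (1 < ordOf τ N → τ (τ^[ordOf τ N - 1] N + 1) = 0 → τ' (N + 1) ≠ 0)) := by
  have hit := fun n hn j => aux_iter_eq h h0' hext n hn j
  have hord := fun n hn => aux_ord_eq h h0' hext n hn
  have hle := fun n hn j => aux_iter_le h n hn j
  constructor
  · rintro ⟨_, _, hB, hC, hD, hE⟩
    refine ⟨?_, ?_, ?_, ?_⟩
    · rw [← hext N hN le_rfl]; exact hB N hN le_rfl
    · intro j hj hj2 hx
      have := hC N hN le_rfl j hj (by rwa [hord N le_rfl])
      rw [hit N le_rfl, hit N le_rfl] at this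
      exact this hx
    · intro j hj hj2 hx he
      have := hD N hN le_rfl j hj (by rwa [hord N le_rfl])
      rw [hit N le_rfl, hit N le_rfl] at this
      refine this hx ?_
      have := hle N le_rfl j
      rwa [hext _ (by omega) (by omega)]
    · intro hr he
      have := hE N hN le_rfl (by rwa [hord N le_rfl])
      rw [hord N le_rfl, hit N le_rfl, aux_ord_one _ _ (by omega)] at this
      apply this
      have := hle N le_rfl (ordOf τ N - 1)
      rwa [hext _ (by omega) (by omega)]
  · rintro ⟨hB', hC', hD', hE'⟩
    obtain ⟨_, hA, hB, hC, hD, hE⟩ := h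
    refine ⟨h0', ?_, ?_, ?_, ?_, ?_⟩
    · unfold PropA at *; rw [hext 1 le_rfl hN, hA]
    · intro n h1 h2
      rw [hext n h1 (by omega)]
      rcases Nat.lt_or_ge n N with h3 | h3
      · rw [hext (n+1) (by omega) (by omega)]; exact hB n h1 h3
      · obtain rfl : n = N := by omega
        exact hB'
    · intro n h1 h2 j hj
      rw [hord n (by omega), hit n (by omega), hit n (by omega)]
      rcases Nat.lt_or_ge n N with h3 | h3
      · rw [hext (n+1) (by omega) (by omega)]; exact hC n h1 h3 j hj
      · obtain rfl : n = N := by omega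
        exact hC' j hj
    · intro n h1 h2 j hj
      have := hle n (by omega) j
      rw [hord n (by omega), hit n (by omega), hit n (by omega)]
      rw [hext (τ^[j] n + 1) (by omega) (by omega)]
      rcases Nat.lt_or_ge n N with h3 | h3
      · rw [hext (n+1) (by omega) (by omega)]; exact hD n h1 h3 j hj
      · obtain rfl : n = N := by omega
        exact hD' j hj
    · intro n h1 h2 hr
      rw [hord n (by omega)] at hr
      have := hle n (by omega) (ordOf τ n - 1)
      rw [hord n (by omega), hit n (by omega), aux_ord_one _ _ (by omega)]
      rw [hext (τ^[ordOf τ n - 1] n + 1) (by omega) (by omega)]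
      rcases Nat.lt_or_ge n N with h3 | h3
      · rw [hext (n+1) (by omega) (by omega)]
        have := hE n h1 h3 hr
        rwa [aux_ord_one _ _ (by omega)] at this
      · obtain rfl : n = N := by omega
        exact hE' hr

/-- Theorem: tau extension: given an admissible τ-function of length `N`
with markers in the orbit of `N` enumerated by `l'₀ = N > l'₁ > ⋯ > l'ₖ` and
`lᵢ = τ(l'ᵢ)`, an extension `τ'` to length `N + 1` is admissible if and only if
`τ'(N+1) = lᵢ + 1` for some `0 ≤ i ≤ k`, or `τ'(N+1) = 0` and (`lₖ > 0` or `k = 0`). -/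
theorem tau_extension (N k : ℕ) (hN : 1 ≤ N) (τ : ℕ → ℕ) (hadm : Admissible N τ)
    (l' : Fin (k + 1) → ℕ) (hl0 : l' 0 = N) (hanti : StrictAnti l')
    (henum : ∀ m, IsMarkerInOrbit N τ m ↔ ∃ i : Fin (k + 1), i ≠ 0 ∧ l' i = m)
    (τ' : ℕ → ℕ) (h0' : τ' 0 = 0) (hext : ∀ n, 1 ≤ n → n ≤ N → τ' n = τ n) :
    Admissible (N + 1) τ' ↔
      ((∃ i : Fin (k + 1), τ' (N + 1) = τ (l' i) + 1) ∨
        (τ' (N + 1) = 0 ∧ (0 < τ (l' (Fin.last k)) ∨ k = 0))) := by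
  rw [aux_step hN hadm h0' hext]
  obtain ⟨hr1, hr0, hrp⟩ := aux_ord_spec hadm N hN le_rfl
  have hle := aux_iter_le hadm N le_rfl
  have hdec : ∀ j, j < ordOf τ N → τ^[j + 1] N < τ^[j] N := by
    intro j hj
    rw [Function.iterate_succ_apply']
    have := hle j
    exact aux_lt hadm _ (hrp j hj) (by omega)
  have hanti2 : ∀ i j, i ≤ j → j ≤ ordOf τ N → τ^[j] N ≤ τ^[i] N := by
    intro i j hij
    induction j, hij using Nat.le_induction with
    | base => intro _; exact le_rfl
    | succ j hj ih =>
      intro h2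
      have := ih (by omega)
      have := hdec j (by omega)
      omega
  have hB : ∀ j, 0 < j → j < ordOf τ N → τ (τ^[j] N + 1) ≤ τ^[j + 1] N + 1 := by
    intro j hj hj2
    rw [Function.iterate_succ_apply']
    have := hle j
    exact hadm.2.2.1 _ (hrp j hj2) (by omega)
  have hmk : ∀ j, 0 < j → j < ordOf τ N → τ (τ^[j] N + 1) < τ^[j + 1] N + 1 →
      ∃ i : Fin (k + 1), i ≠ 0 ∧ l' i = τ^[j] N := by
    intro j hj hj2 hlt
    rw [← henum]
    have := hle j
    rw [Function.iterate_succ_apply'] at hlt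
    exact ⟨⟨hrp j hj2, by omega, hlt⟩, j, hj, rfl⟩
  have hmk2 : ∀ i : Fin (k + 1), i ≠ 0 → ∃ j, 0 < j ∧ j < ordOf τ N ∧ l' i = τ^[j] N ∧
      τ (τ^[j] N + 1) < τ^[j + 1] N + 1 := by
    intro i hi
    obtain ⟨⟨h1, h2, h3⟩, j, hj, he⟩ := (henum (l' i)).2 ⟨i, hi, rfl⟩
    refine ⟨j, hj, ?_, he.symm, ?_⟩
    · by_contra hcon
      obtain ⟨d, rfl⟩ := Nat.exists_eq_add_of_le (Nat.le_of_not_lt hcon)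
      rw [Nat.add_comm, Function.iterate_add_apply, hr0, Function.iterate_fixed hadm.1] at he
      omega
    · rw [Function.iterate_succ_apply', he]; exact h3
  generalize τ' (N + 1) = x
  constructor
  · rintro ⟨hxB, hxC, hxD, hxE⟩
    have key : ∀ j, 1 ≤ j → j ≤ ordOf τ N →
        (∃ i : Fin (k + 1), x = τ (l' i) + 1) ∨ x < τ^[j] N + 1 := by
      intro j hj
      induction j, hj using Nat.le_induction with
      | base =>
        intro _
        rcases Nat.lt_or_ge x (τ N + 1) with h | h
        · right; simpa using h
        · left; exact ⟨0, by rw [hl0]; omega⟩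
      | succ j hj ih =>
        intro h2
        rcases ih (by omega) with h | h
        · exact Or.inl h
        · have hc := hxC j hj h2 h
          rcases Nat.lt_or_ge x (τ^[j + 1] N + 1) with h3 | h3
          · exact Or.inr h3
          · left
            have hne : τ (τ^[j] N + 1) ≠ τ^[j + 1] N + 1 := fun he => by
              have := hxD j hj h2 h he
              omega
            have hb := hB j hj h2
            obtain ⟨i, _, hi⟩ := hmk j hj h2 (by omega)
            refine ⟨i, ?_⟩
            rw [hi, ← Function.iterate_succ_apply' τ, Nat.succ_eq_add_one]
            omega
    rcases key _ hr1 le_rfl with h | h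
    · exact Or.inl h
    · right
      rw [hr0] at h
      have hx0 : x = 0 := by omega
      refine ⟨hx0, ?_⟩
      by_contra hcon
      have hk : k ≠ 0 := fun h => hcon (Or.inr h)
      have hl : τ (l' (Fin.last k)) = 0 := by
        by_contra hh
        exact hcon (Or.inl (by omega))
      obtain ⟨j, hj, hj2, hj3, hj4⟩ := hmk2 (Fin.last k) (by
        intro he; apply hk; simpa [Fin.ext_iff] using he)
      rw [hj3, ← Function.iterate_succ_apply' τ, Nat.succ_eq_add_one] at hl
      have hjr : j = ordOf τ N - 1 := by
        by_contra hne
        have := hrp (j + 1) (by omega)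
        omega
      refine hxE (by omega) ?_ hx0
      rw [← hjr]; omega
  · rintro (⟨i, hi⟩ | ⟨hx0, hlk⟩)
    · by_cases hi0 : i = 0
      · subst hi0
        rw [hl0] at hi
        have hx : ∀ j, 0 < j → j < ordOf τ N → ¬ x < τ^[j] N + 1 := by
          intro j hj hj2 hlt
          have := hanti2 1 j hj hj2.le
          simp at this
          omega
        exact ⟨by omega, fun j h1 h2 h3 => absurd h3 (hx j h1 h2),
          fun j h1 h2 h3 => absurd h3 (hx j h1 h2), fun _ _ => by omega⟩
      · obtain ⟨j, hj, hj2, hj3, hj4⟩ := hmk2 i hi0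
        rw [hj3, ← Function.iterate_succ_apply' τ, Nat.succ_eq_add_one] at hi
        have hlt : ∀ m, 0 < m → m < ordOf τ N → x < τ^[m] N + 1 → m ≤ j := by
          intro m h1 h2 h3
          by_contra h4
          have := hanti2 (j + 1) m (by omega) h2.le

          omega
        refine ⟨?_, ?_, ?_, ?_⟩
        · have := hanti2 1 (j + 1) (by omega) hj2
          rw [Function.iterate_one] at this

          omega
        · intro m h1 h2 h3
          have := hlt m h1 h2 h3
          have := hanti2 (m + 1) (j + 1) (by omega) hj2

          omega
        · intro m h1 h2 h3 h4
          have h5 := hlt m h1 h2 h3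
          have h6 : m ≠ j := by rintro rfl; omega
          have := hanti2 (m + 1) j (by omega) hj2.le
          have := hdec j hj2

          omega
        · intro _ _; omega
    · subst hx0
      refine ⟨by omega, fun _ _ _ _ => by omega, fun _ _ _ _ _ => by omega, ?_⟩
      intro h1 h2 _
      have hs : ordOf τ N - 1 + 1 = ordOf τ N := by omega
      obtain ⟨i, hi0, hi⟩ := hmk (ordOf τ N - 1) (by omega) (by omega) (by omega)
      have hk : k ≠ 0 := by
        rintro rfl
        exact hi0 (Fin.ext (by simp))
      have hl : 0 < τ (l' (Fin.last k)) := hlk.resolve_right hk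
      obtain ⟨j, hj, hj2, hj3, hj4⟩ := hmk2 (Fin.last k) (by
        intro he; apply hk; simpa [Fin.ext_iff] using he)
      have hll : l' (Fin.last k) ≤ l' i := hanti.antitone (Fin.le_last i)
      have hjr : j = ordOf τ N - 1 := by
        by_contra hne
        have := hanti2 (j + 1) (ordOf τ N - 1) (by omega) (by omega)
        have := hdec j hj2
        omega
      rw [hj3, ← Function.iterate_succ_apply' τ, Nat.succ_eq_add_one, hjr, hs] at hl
      omega
end

section
/- Let τ be an admissible τ-function of length N+1 with τ(N+1) ≠ 0, and let l_0' = N, l_1' > ⋯ > l_k' be the markers of the restriction τ|{1,…,N} appearing in the orbit of N, with l_i = τ(l_i'). Then τ(N+1) = l_i + 1 for some 0 ≤ i ≤ k. -/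
open Function

/-- for an admissible τ-function of length `N + 1` with `τ(N+1) ≠ 0`,
letting `l'₀ = N > l'₁ > ⋯ > l'ₖ` be the markers of `τ|{1,…,N}` in the orbit of `N`
and `lᵢ = τ(l'ᵢ)`, we have `τ(N+1) = lᵢ + 1` for some `0 ≤ i ≤ k`. -/
theorem tau_succ_is_marker_value (N k : ℕ) (hN : 1 ≤ N) (τ : ℕ → ℕ)
    (hadm : Admissible (N + 1) τ) (hne : τ (N + 1) ≠ 0)
    (l' : Fin (k + 1) → ℕ) (hl0 : l' 0 = N) (hanti : StrictAnti l')
    (henum : ∀ m, IsMarkerInOrbit N τ m ↔ ∃ i : Fin (k + 1), i ≠ 0 ∧ l' i = m) :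
    ∃ i : Fin (k + 1), τ (N + 1) = τ (l' i) + 1 := by
  obtain ⟨h0, hA, hB, hC, hD, -⟩ := hadm
  have hlt : ∀ n, 1 ≤ n → n ≤ N + 1 → τ n < n := by
    intro n h1
    induction n, h1 using Nat.le_induction with
    | base => intro _; rw [hA]; omega
    | succ n h1 ih =>
      intro h2
      have := hB n h1 h2
      have := ih (by omega)
      omega
  have hdec : ∀ j, τ^[j] N ≤ N - j := by
    intro j
    induction j with
    | zero => simp
    | succ j ih =>
      rw [Function.iterate_succ_apply']
      rcases Nat.eq_zero_or_pos (τ^[j] N) with h | h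
      · rw [h, h0]; omega
      · have := hlt _ h (by omega)
        omega
  have hle := hB N hN le_rfl
  by_cases heq : τ (N + 1) = τ N + 1
  · exact ⟨0, by rw [hl0]; exact heq⟩
  have hz : τ^[N] N = 0 := by have := hdec N; omega
  have hex : ∃ j, τ^[j] N < τ (N + 1) := ⟨N, by omega⟩
  classical
  obtain ⟨j, hj, hmin⟩ : ∃ j, τ^[j] N < τ (N + 1) ∧ ∀ i, i < j → τ (N + 1) ≤ τ^[i] N :=
    ⟨Nat.find hex, Nat.find_spec hex, fun i hi => by
      have := Nat.find_min hex hi; omega⟩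
  have hN1 := hlt N hN (by omega)
  match j, hj, hmin with
  | 0, hj, _ => simp at hj; omega
  | 1, hj, _ => simp at hj; omega
  | j + 2, hj, hmin =>
    have hk := hmin (j + 1) (by omega)
    have hord : j + 1 < ordOf τ N := by
      by_contra hcon
      have hm : τ^[ordOf τ N] N = 0 := Nat.sInf_mem (s := {m | τ^[m] N = 0}) ⟨N, hz⟩
      have := hmin (ordOf τ N) (by omega)
      omega
    have hc := hC N hN le_rfl (j + 1) (by omega) hord (by omega)
    have hd := hD N hN le_rfl (j + 1) (by omega) hord (by omega)
    have hd1 := hdec (j + 1)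
    have hs : τ^[j + 1 + 1] N = τ (τ^[j + 1] N) := Function.iterate_succ_apply' ..
    have hj' : τ^[j + 1 + 1] N < τ (N + 1) := hj
    have hb := hB (τ^[j + 1] N) (by omega) (by omega)
    have hmk : IsMarkerInOrbit N τ (τ^[j + 1] N) := by
      refine ⟨⟨by omega, by omega, ?_⟩, j + 1, by omega, rfl⟩
      by_contra hcon
      have := hd (by omega)
      omega
    obtain ⟨i, -, hi⟩ := (henum _).1 hmk
    exact ⟨i, by rw [hi]; omega⟩
end

section
/- Let τ be an admissible τ-function of length N, and suppose that the number k of markers of τ appearing in the orbit of N satisfies k > 0 and that l_k = τ(l_k') = 0, where l_k' is the smallest such marker. Then every admissible extension τ' of τ to length N+1 satisfies τ'(N+1) ≠ 0. -/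
open Function

/-- if an admissible τ-function of length `N` has `k > 0` markers in the
orbit of `N` and `lₖ = τ(l'ₖ) = 0` for the smallest such marker `l'ₖ`, then every
admissible extension `τ'` to length `N + 1` has `τ'(N+1) ≠ 0`. -/
theorem extension_nonzero (N k : ℕ) (hN : 1 ≤ N) (τ : ℕ → ℕ) (hadm : Admissible N τ)
    (hk : 0 < k)
    (l' : Fin (k + 1) → ℕ) (hl0 : l' 0 = N) (hanti : StrictAnti l')
    (henum : ∀ m, IsMarkerInOrbit N τ m ↔ ∃ i : Fin (k + 1), i ≠ 0 ∧ l' i = m)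
    (hlk : τ (l' (Fin.last k)) = 0)
    (τ' : ℕ → ℕ) (hadm' : Admissible (N + 1) τ')
    (hext : ∀ n, 1 ≤ n → n ≤ N → τ' n = τ n) :
    τ' (N + 1) ≠ 0 := by
  obtain ⟨h0, hA, hB, -⟩ := hadm
  obtain ⟨h0', -, -, -, -, hE⟩ := hadm'
  have hlast : Fin.last k ≠ 0 := by
    intro h
    have := congrArg Fin.val h
    simp at this
    omega
  obtain ⟨⟨hm1, hmN, hmk⟩, j, hj, hjm⟩ := (henum _).2 ⟨Fin.last k, hlast, rfl⟩
  generalize l' (Fin.last k) = m at *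
  have hle : ∀ n, n ≤ N → τ n ≤ n := by
    intro n
    induction n with
    | zero => intro _; omega
    | succ n ih =>
      intro hn
      rcases Nat.eq_zero_or_pos n with rfl | hp
      · have : τ 1 = 0 := hA
        simp [this]
      · have := hB n hp hn
        have := ih (by omega)
        omega
  have heq : ∀ n, n ≤ N → τ' n = τ n := by
    intro n hn
    rcases Nat.eq_zero_or_pos n with rfl | hp
    · rw [h0, h0']
    · exact hext n hp hn
  have hit : ∀ i, τ'^[i] N = τ^[i] N ∧ τ^[i] N ≤ N := by
    intro i
    induction i with
    | zero => simp
    | succ i ih =>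
      rw [Function.iterate_succ_apply', Function.iterate_succ_apply', ih.1]
      exact ⟨heq _ ih.2, (hle _ ih.2).trans ih.2⟩
  have hjm' : τ'^[j] N = m := by rw [(hit j).1, hjm]
  have hz : ∀ i, τ'^[i] 0 = 0 := fun i => Function.iterate_fixed h0' i
  have hord : ordOf τ' N = j + 1 := by
    unfold ordOf
    apply le_antisymm
    · apply Nat.sInf_le
      show τ'^[j + 1] N = 0
      rw [Function.iterate_succ_apply', hjm', heq m (by omega), hlk]
    · apply le_csInf
      · refine ⟨j + 1, ?_⟩
        show τ'^[j + 1] N = 0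
        rw [Function.iterate_succ_apply', hjm', heq m (by omega), hlk]
      · intro b hb
        by_contra hlt
        have hb' : τ'^[b] N = 0 := hb
        have : τ'^[j] N = 0 := by
          have e : j = (j - b) + b := by omega
          rw [e, Function.iterate_add_apply, hb', hz]
        omega
  have hm1z : τ' (m + 1) = 0 := by
    rw [heq (m + 1) hmN]; omega
  have hord1 : ordOf τ' (m + 1) = 1 := by
    unfold ordOf
    apply le_antisymm
    · apply Nat.sInf_le
      show τ'^[1] (m + 1) = 0
      simpa using hm1z
    · apply le_csInf
      · exact ⟨1, by show τ'^[1] (m + 1) = 0; simpa using hm1z⟩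
      · intro b hb
        by_contra hlt
        have hb0 : b = 0 := by omega
        subst hb0
        have hb' : m + 1 = 0 := hb
        omega
  apply hE N hN le_rfl
  · rw [hord]; omega
  · rw [hord, Nat.add_sub_cancel, hjm', hord1]
end

section
/- For every integer N with 1 ≤ N ≤ 5, the number of admissible τ-functions of length N equals 2^{N−1} (namely 1, 2, 4, 8, 16 for N = 1, 2, 3, 4, 5). -/
open Function

namespace TauAux

abbrev T := Fin 2 × Fin 3 × Fin 4 × Fin 5

def ext (t : T) : ℕ → ℕ
  | 2 => t.1
  | 3 => t.2.1
  | 4 => t.2.2.1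
  | 5 => t.2.2.2
  | _ => 0

def ordC (τ : ℕ → ℕ) (n : ℕ) : ℕ :=
  if n = 0 then 0 else if τ n = 0 then 1 else if τ (τ n) = 0 then 2
  else if τ (τ (τ n)) = 0 then 3 else if τ (τ (τ (τ n))) = 0 then 4 else 5

theorem ordOf_eq (τ : ℕ → ℕ) (n m : ℕ) (h : τ^[m] n = 0) (h' : ∀ j < m, τ^[j] n ≠ 0) :
    ordOf τ n = m := by
  unfold ordOf
  apply le_antisymm
  · exact Nat.sInf_le h
  · apply le_csInf ⟨m, h⟩
    intro j hj
    by_contra hc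
    exact h' j (by omega) hj

theorem ordC_small : ∀ t : T, ∀ n < 6, (ext t)^[ordC (ext t) n] n = 0 ∧
    ∀ j < ordC (ext t) n, (ext t)^[j] n ≠ 0 := by
  decide +kernel

theorem ext_big (t : T) (n : ℕ) (h : 6 ≤ n) : ext t n = 0 := by
  obtain ⟨k, rfl⟩ := Nat.exists_eq_add_of_le' h
  rfl

theorem ordOf_ext (t : T) (n : ℕ) : ordOf (ext t) n = ordC (ext t) n := by
  by_cases h : n < 6
  · exact ordOf_eq _ _ _ (ordC_small t n h).1 (ordC_small t n h).2
  · have h0 := ext_big t n (by omega)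
    have h1 : ordC (ext t) n = 1 := by
      unfold ordC
      rw [if_neg (by omega), if_pos h0]
    rw [h1]
    apply ordOf_eq
    · simpa using h0
    · intro j hj
      have : j = 0 := by omega
      subst this
      simp; omega

def Chk (N : ℕ) (τ : ℕ → ℕ) : Prop :=
  (∀ n < N, 1 ≤ n → τ (n + 1) ≤ τ n + 1) ∧
  (∀ n < N, 1 ≤ n → ∀ k < ordC τ n, 0 < k →
    τ (n + 1) < τ^[k] n + 1 → τ (n + 1) ≤ τ^[k + 1] n + 1) ∧
  (∀ n < N, 1 ≤ n → ∀ k < ordC τ n, 0 < k →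
    τ (n + 1) < τ^[k] n + 1 → τ (τ^[k] n + 1) = τ^[k + 1] n + 1 →
      τ (n + 1) < τ^[k + 1] n + 1) ∧
  (∀ n < N, 1 ≤ n → 1 < ordC τ n →
    ordC τ (τ^[ordC τ n - 1] n + 1) = 1 → τ (n + 1) ≠ 0) ∧
  (∀ n < 6, N < n → τ n = 0)

set_option synthInstance.maxSize 4000 in
set_option synthInstance.maxHeartbeats 400000 in
instance (N : ℕ) (τ : ℕ → ℕ) : Decidable (Chk N τ) := by
  unfold Chk
  infer_instance

theorem tau_iff (N : ℕ) (t : T) : TauFunction N (ext t) ↔ Chk N (ext t) := by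
  unfold TauFunction Admissible PropA PropB PropC PropD PropE Chk
  simp only [ordOf_ext]
  constructor
  · rintro ⟨⟨-, -, hB, hC, hD, hE⟩, hz⟩
    exact ⟨fun n h h1 => hB n h1 h, fun n h h1 k hk h0 => hC n h1 h k h0 hk,
      fun n h h1 k hk h0 => hD n h1 h k h0 hk, fun n h h1 => hE n h1 h, fun n _ h => hz n h⟩
  · rintro ⟨hB, hC, hD, hE, hz⟩
    refine ⟨⟨rfl, rfl, fun n h1 h => hB n h h1, fun n h1 h k h0 hk => hC n h h1 k hk h0,
      fun n h1 h k h0 hk => hD n h h1 k hk h0, fun n h1 h => hE n h h1⟩, fun n h => ?_⟩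
    by_cases h6 : n < 6
    · exact hz n h6 h
    · exact ext_big t n (by omega)

theorem ext_inj (s t : T) (h : ext s = ext t) : s = t := by
  obtain ⟨a, b, c, d⟩ := s
  obtain ⟨a', b', c', d'⟩ := t
  have h2 : (a : ℕ) = a' := congrFun h 2
  have h3 : (b : ℕ) = b' := congrFun h 3
  have h4 : (c : ℕ) = c' := congrFun h 4
  have h5 : (d : ℕ) = d' := congrFun h 5
  simp only [Prod.mk.injEq]
  exact ⟨Fin.ext h2, Fin.ext h3, Fin.ext h4, Fin.ext h5⟩

theorem ext_surj (N : ℕ) (hN : N ≤ 5) (τ : ℕ → ℕ) (h : TauFunction N τ) :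
    ∃ t, ext t = τ := by
  obtain ⟨⟨h0, h1, hB, -, -, -⟩, hz⟩ := h
  have h1 : τ 1 = 0 := h1
  have key : ∀ n, 1 ≤ n → τ (n + 1) ≤ τ n + 1 := by
    intro n hn
    by_cases h : n + 1 ≤ N
    · exact hB n hn h
    · rw [hz (n + 1) (by omega)]; omega
  have h2 := key 1 (by omega)
  have h3 := key 2 (by omega)
  have h4 := key 3 (by omega)
  have h5 := key 4 (by omega)
  norm_num at h2 h3 h4 h5
  refine ⟨(⟨τ 2, by omega⟩, ⟨τ 3, by omega⟩, ⟨τ 4, by omega⟩, ⟨τ 5, by omega⟩), ?_⟩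
  funext n
  match n with
  | 0 => exact h0.symm
  | 1 => exact h1.symm
  | 2 => rfl
  | 3 => rfl
  | 4 => rfl
  | 5 => rfl
  | k + 6 => exact (hz (k + 6) (by omega)).symm

theorem card_eq (N : ℕ) (hN : N ≤ 5) :
    Nat.card {τ : ℕ → ℕ // TauFunction N τ} = Fintype.card {t : T // Chk N (ext t)} := by
  rw [← Nat.card_eq_fintype_card]
  symm
  apply Nat.card_congr
  refine Equiv.ofBijective (fun t => ⟨ext t.1, (tau_iff N t.1).2 t.2⟩) ⟨?_, ?_⟩
  · intro s t h
    exact Subtype.ext (ext_inj _ _ (congrArg Subtype.val h))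
  · rintro ⟨τ, h⟩
    obtain ⟨t, rfl⟩ := ext_surj N hN τ h
    exact ⟨⟨t, (tau_iff N t).1 h⟩, rfl⟩

theorem cards : ∀ N < 6, 1 ≤ N → Fintype.card {t : T // Chk N (ext t)} = 2 ^ (N - 1) := by
  decide +kernel

end TauAux

/-- for `1 ≤ N ≤ 5`, the number of admissible τ-functions of length `N`
equals `2^(N-1)` (namely 1, 2, 4, 8, 16). -/
theorem card_tau_small_levels :
    ∀ N : ℕ, 1 ≤ N → N ≤ 5 →
      Nat.card {τ : ℕ → ℕ // TauFunction N τ} = 2 ^ (N - 1) := by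
  intro N h1 h5
  rw [TauAux.card_eq N h5]
  exact TauAux.cards N (by omega) h1
end

section
/- The number of admissible τ-functions of length 8 equals 144. -/
open Function

def ordF (τ : ℕ → ℕ) : ℕ → ℕ → ℕ
  | 0, _ => 0
  | k + 1, n => if n = 0 then 0 else ordF τ k (τ n) + 1

theorem ordOf_zero' (τ : ℕ → ℕ) : ordOf τ 0 = 0 := by
  unfold ordOf
  exact Nat.sInf_eq_zero.2 (Or.inl rfl)

theorem iter_zero_of (τ : ℕ → ℕ) (h : ∀ n, n ≤ 8 → τ n ≤ n - 1) :
    ∀ n, n ≤ 8 → ∃ m, τ^[m] n = 0 := by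
  intro n
  induction n using Nat.strong_induction_on with
  | _ n ih =>
    intro hn
    rcases Nat.eq_zero_or_pos n with h0 | h0
    · exact ⟨0, h0⟩
    · have := h n hn
      obtain ⟨m, hm⟩ := ih (τ n) (by omega) (by omega)
      exact ⟨m + 1, hm⟩

theorem ordOf_succ' (τ : ℕ → ℕ) (n : ℕ) (hn : n ≠ 0) (h : ∃ m, τ^[m] (τ n) = 0) :
    ordOf τ n = ordOf τ (τ n) + 1 := by
  have h1 : τ^[ordOf τ (τ n)] (τ n) = 0 := Nat.sInf_mem (s := {m | τ^[m] (τ n) = 0}) h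
  have h2 : τ^[ordOf τ n] n = 0 :=
    Nat.sInf_mem (s := {m | τ^[m] n = 0}) ⟨_ + 1, h1⟩
  apply le_antisymm
  · exact Nat.sInf_le (s := {m | τ^[m] n = 0}) h1
  · cases hk : ordOf τ n with
    | zero => rw [hk] at h2; exact absurd h2 hn
    | succ k =>
      rw [hk] at h2
      exact Nat.succ_le_succ (Nat.sInf_le (s := {m | τ^[m] (τ n) = 0}) h2)

theorem ordOf_eq (τ : ℕ → ℕ) (h : ∀ n, n ≤ 8 → τ n ≤ n - 1) :
    ∀ k n, n ≤ k → n ≤ 8 → ordOf τ n = ordF τ k n := by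
  intro k
  induction k with
  | zero =>
    intro n hn _
    obtain rfl : n = 0 := by omega
    exact ordOf_zero' τ
  | succ k ih =>
    intro n hn h8
    by_cases h0 : n = 0
    · subst h0; simp [ordF, ordOf_zero']
    · have := h n h8
      rw [ordOf_succ' τ n h0 (iter_zero_of τ h _ (by omega)), ih _ (by omega) (by omega)]
      simp [ordF, h0]

theorem iter_le (τ : ℕ → ℕ) (h : ∀ n, n ≤ 8 → τ n ≤ n - 1) :
    ∀ k n, n ≤ 8 → τ^[k] n ≤ n := by
  intro k
  induction k with
  | zero => intro n _; exact le_rfl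
  | succ k ih =>
    intro n hn
    have := h n hn
    have := ih (τ n) (by omega)
    rw [Function.iterate_succ_apply]
    omega

def PK (τ : ℕ → ℕ) (n k : ℕ) : Prop :=
  0 < k → τ (n + 1) < τ^[k] n + 1 →
      (τ (n + 1) ≤ τ^[k + 1] n + 1 ∧
        (τ (τ^[k] n + 1) = τ^[k + 1] n + 1 → τ (n + 1) < τ^[k + 1] n + 1))

instance (τ : ℕ → ℕ) (n k : ℕ) : Decidable (PK τ n k) := by unfold PK; infer_instance

def PN (τ : ℕ → ℕ) (n : ℕ) : Prop :=
  1 ≤ n →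
    (τ (n + 1) ≤ τ n + 1 ∧
    (∀ k, k < ordF τ 8 n → PK τ n k) ∧
    (1 < ordF τ 8 n → ordF τ 8 (τ^[ordF τ 8 n - 1] n + 1) = 1 → τ (n + 1) ≠ 0))

instance (τ : ℕ → ℕ) (n : ℕ) : Decidable (PN τ n) := by unfold PN; infer_instance

/-- Decidable version of the conditions. -/
def PP (τ : ℕ → ℕ) : Prop :=
  (∀ n, n < 9 → τ n ≤ n - 1) ∧ ∀ n, n < 8 → PN τ n

instance (τ : ℕ → ℕ) : Decidable (PP τ) := by unfold PP; infer_instance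

theorem adm_bound (τ : ℕ → ℕ) (h : Admissible 8 τ) : ∀ n, n ≤ 8 → τ n ≤ n - 1 := by
  obtain ⟨h0, h1, hB, -⟩ := h
  intro n
  induction n with
  | zero => intro _; rw [h0]
  | succ n ih =>
    intro hn
    rcases Nat.eq_zero_or_pos n with rfl | hp
    · exact le_of_eq h1
    · have := hB n hp hn
      have := ih (by omega)
      omega

theorem adm_iff (τ : ℕ → ℕ) : Admissible 8 τ ↔ PP τ := by
  constructor
  · intro h
    have hb := adm_bound τ h
    obtain ⟨h0, h1, hB, hC, hD, hE⟩ := h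
    refine ⟨fun n hn => hb n (by omega), fun n hn h1n => ⟨hB n h1n hn, ?_, ?_⟩⟩
    · rw [← ordOf_eq τ hb 8 n (by omega) (by omega)]
      intro k hk hk0 hlt
      exact ⟨hC n h1n hn k hk0 hk hlt, hD n h1n hn k hk0 hk hlt⟩
    · have hi := iter_le τ hb (ordOf τ n - 1) n (by omega)
      rw [← ordOf_eq τ hb 8 n (by omega) (by omega),
        ← ordOf_eq τ hb 8 _ (by omega) (by omega)]
      exact hE n h1n hn
  · rintro ⟨hb', h⟩
    have hb : ∀ n, n ≤ 8 → τ n ≤ n - 1 := fun n hn => hb' n (by omega)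
    refine ⟨Nat.le_zero.1 (hb 0 (by omega)), Nat.le_zero.1 (hb 1 (by omega)),
      fun n h1 hn => (h n hn h1).1, ?_, ?_, ?_⟩
    · intro n h1 hn k hk0 hk hlt
      rw [ordOf_eq τ hb 8 n (by omega) (by omega)] at hk
      exact ((h n hn h1).2.1 k hk hk0 hlt).1
    · intro n h1 hn k hk0 hk hlt
      rw [ordOf_eq τ hb 8 n (by omega) (by omega)] at hk
      exact ((h n hn h1).2.1 k hk hk0 hlt).2
    · intro n h1 hn
      have hi := iter_le τ hb (ordOf τ n - 1) n (by omega)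
      rw [ordOf_eq τ hb 8 _ (by omega) (by omega : τ^[ordOf τ n - 1] n + 1 ≤ 8),
        ordOf_eq τ hb 8 n (by omega) (by omega)]
      exact (h n hn h1).2.2

theorem iter_agree (τ σ : ℕ → ℕ) (N : ℕ) (hb : ∀ m, m ≤ N → τ m ≤ m)
    (h : ∀ m, m ≤ N → σ m = τ m) :
    ∀ k m, m ≤ N → σ^[k] m = τ^[k] m ∧ τ^[k] m ≤ m := by
  intro k
  induction k with
  | zero => intro m _; exact ⟨rfl, le_rfl⟩
  | succ k ih =>
    intro m hm
    have h1 := hb m hm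
    have h2 := ih (τ m) (by omega)
    rw [Function.iterate_succ_apply, Function.iterate_succ_apply, h m hm]
    exact ⟨h2.1, h2.2.trans h1⟩

theorem ordF_agree (τ σ : ℕ → ℕ) (N : ℕ) (hb : ∀ m, m ≤ N → τ m ≤ m)
    (h : ∀ m, m ≤ N → σ m = τ m) :
    ∀ k m, m ≤ N → ordF σ k m = ordF τ k m := by
  intro k
  induction k with
  | zero => intro m _; rfl
  | succ k ih =>
    intro m hm
    have h1 := hb m hm
    rw [ordF, ordF, h m hm, ih (τ m) (by omega)]

theorem PN_agree (τ σ : ℕ → ℕ) (n : ℕ) (hb : ∀ m, m ≤ n + 1 → τ m ≤ m)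
    (h : ∀ m, m ≤ n + 1 → σ m = τ m) (hp : PN τ n) : PN σ n := by
  have hi := fun k => iter_agree τ σ (n + 1) hb h k n (by omega)
  have ho := ordF_agree τ σ (n + 1) hb h 8
  intro h1
  obtain ⟨a, b, c⟩ := hp h1
  rw [ho n (by omega), (hi _).1, ho _ (by have := (hi (ordF τ 8 n - 1)).2; omega),
    h (n + 1) le_rfl, h n (by omega)]
  refine ⟨a, fun k hk => ?_, c⟩
  have := b k hk
  unfold PK at this ⊢
  rw [h (n + 1) le_rfl, (hi _).1, (hi _).1, h _ (by have := (hi k).2; omega)]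
  exact this

/-- Candidates `[τ (n+1), …, τ 0]`. -/
def cands : ℕ → List (List ℕ)
  | 0 => [[0, 0]]
  | n + 1 => (cands n).flatMap fun l =>
      ((List.range (l.headD 0 + 2)).map fun v => v :: l).filter fun l =>
        decide (PN (fun m => l.reverse.getD m 0) (n + 1))

theorem mem_cands (τ : ℕ → ℕ) (h : Admissible 8 τ) :
    ∀ n, n ≤ 7 → ((List.range (n + 2)).map τ).reverse ∈ cands n := by
  have hPP := (adm_iff τ).1 h
  obtain ⟨h0, h1, hB, -⟩ := h
  intro n
  induction n with
  | zero =>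
    intro _
    have h1' : τ 1 = 0 := h1
    simp [cands, List.range_succ, h0, h1']
  | succ n ih =>
    intro hn
    rw [cands, List.mem_flatMap]
    refine ⟨_, ih (by omega), ?_⟩
    have hs : ((List.range (n + 1 + 2)).map τ).reverse
        = τ (n + 2) :: ((List.range (n + 2)).map τ).reverse := by
      rw [List.range_succ (n := n + 2)]
      simp
    rw [List.mem_filter, decide_eq_true_iff, List.reverse_reverse]
    refine ⟨?_, ?_⟩
    · rw [hs, List.mem_map]
      refine ⟨τ (n + 2), ?_, rfl⟩
      have : τ (n + 2) ≤ τ (n + 1) + 1 := hB (n + 1) (by omega) (by omega)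
      simp [List.range_succ (n := n + 1)]
      omega
    · refine PN_agree τ _ (n + 1) ?_ ?_ (hPP.2 (n + 1) (by omega))
      · intro m hm
        have := hPP.1 m (by omega)
        omega
      · intro m hm
        have : m < n + 1 + 2 := by omega
        simp [List.getD, this]

def good (L : List (List ℕ)) : List (List ℕ) :=
  L.filter fun l => decide (l.length = 9 ∧ PP fun n => l.getD n 0)

theorem good_card : (good ((cands 7).map List.reverse)).toFinset.card = 144 := by
  decide +kernel

theorem mem_good (L : List (List ℕ)) (l : List ℕ) : l ∈ (good L).toFinset ↔
    l ∈ L ∧ l.length = 9 ∧ PP fun n => l.getD n 0 := by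
  rw [List.mem_toFinset, good, List.mem_filter, decide_eq_true_iff]

theorem getD_map (τ : ℕ → ℕ) (h : ∀ n, 8 < n → τ n = 0) :
    (fun n => ((List.range 9).map τ).getD n 0) = τ := by
  funext n
  by_cases hn : n < 9
  · simp [List.getD, hn]
  · simp [List.getD, hn, h n (by omega)]

def tauEquiv : {τ : ℕ → ℕ // TauFunction 8 τ} ≃ (good ((cands 7).map List.reverse)).toFinset where
  toFun τ := ⟨(List.range 9).map τ.1, by
    rw [mem_good]
    refine ⟨List.mem_map.2 ⟨_, mem_cands τ.1 τ.2.1 7 le_rfl, List.reverse_reverse _⟩, ?_⟩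
    rw [getD_map τ.1 τ.2.2]
    exact ⟨by simp, (adm_iff _).1 τ.2.1⟩⟩
  invFun l := ⟨fun n => l.1.getD n 0, by
    have hl := l.2
    rw [mem_good] at hl
    refine ⟨(adm_iff _).2 hl.2.2, fun n hn => ?_⟩
    have := hl.2.1
    exact List.getD_eq_default _ _ (by omega)⟩
  left_inv τ := Subtype.ext (getD_map τ.1 τ.2.2)
  right_inv l := by
    have hl := l.2
    rw [mem_good] at hl
    apply Subtype.ext
    apply List.ext_getElem
    · simp [hl.2.1]
    · intro i h1 h2
      simp [List.getD, h2]

/-- the number of admissible τ-functions of length 8 equals 144. -/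
theorem card_tau_length_8 :
    Nat.card {τ : ℕ → ℕ // TauFunction 8 τ} = 144 := by
  rw [Nat.card_congr tauEquiv, Nat.card_eq_fintype_card, Fintype.card_coe, good_card]
end

section
/- The number of admissible τ-functions of length 11 equals 1361. -/
open Function

namespace TauCount

def q (f : ℕ → ℕ) (x v : ℕ) : Bool :=
  (!(Nat.ble v x) || (Nat.ble v (f x + 1) &&
    (!(Nat.beq (f (x+1)) (f x + 1)) || Nat.ble (v+1) (f x + 1)))) &&
  (!(Nat.beq (f x) 0) || !(Nat.beq (f (x+1)) 0) || !(Nat.beq v 0))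

def walk (f : ℕ → ℕ) (v : ℕ) : ℕ → ℕ → Bool
  | 0, _ => true
  | fuel+1, x => Nat.beq x 0 || (q f x v && walk f v fuel (f x))

def ok (f : ℕ → ℕ) (n v : ℕ) : Bool := Nat.ble v (f n + 1) && walk f v n (f n)

def look : List ℕ → ℕ → ℕ
  | [], _ => 0
  | a :: _, 0 => a
  | _ :: l, i+1 => look l i

def gen : ℕ → List (List ℕ)
  | 0 => [[0,0]]
  | N+1 => (gen N).flatMap fun l =>
      ((List.range (N+2)).filter (ok (look l) (N+1))).map (fun v => l ++ [v])

theorem gen_len : (gen 10).length = 1361 := by decide +kernel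

theorem look_map (g : ℕ → ℕ) (n : ℕ) : ∀ (l : List ℕ), n < l.length →
    look (l.map g) n = g (l.getD n 0) := by
  induction n with
  | zero => intro l h; cases l <;> simp_all [look]
  | succ n ih =>
    intro l h
    cases l with
    | nil => simp at h
    | cons a l => simpa [look] using ih l (by simpa using h)

theorem look_range (τ : ℕ → ℕ) (N n : ℕ) (h : n < N) :
    look ((List.range N).map τ) n = τ n := by
  rw [look_map _ _ _ (by simpa using h)]
  simp [h]

theorem q_iff (f : ℕ → ℕ) (x v : ℕ) : q f x v = true ↔
    (v < x + 1 → v ≤ f x + 1) ∧ (v < x + 1 → f (x+1) = f x + 1 → v < f x + 1) ∧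
    (f x = 0 → f (x+1) = 0 → v ≠ 0) := by
  simp only [q, Bool.and_eq_true, Bool.or_eq_true, Bool.not_eq_true', ← Bool.not_eq_true,
    Nat.ble_eq, Nat.beq_eq]
  grind

theorem walk_iff (f : ℕ → ℕ) (v : ℕ) (h0 : f 0 = 0) : ∀ fuel x, x ≤ fuel →
    (∀ y, 0 < y → y ≤ x → f y < y) →
    (walk f v fuel x = true ↔ ∀ k, f^[k] x ≠ 0 → q f (f^[k] x) v = true) := by
  have hz : ∀ k, f^[k] 0 = 0 := fun k => Function.iterate_fixed h0 k
  intro fuel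
  induction fuel with
  | zero =>
    intro x hx _
    obtain rfl : x = 0 := by omega
    simp [walk, hz]
  | succ m ih =>
    intro x hx hd
    rcases Nat.eq_zero_or_pos x with rfl | hp
    · simp [walk, hz]
    · have h1 := hd x hp le_rfl
      have := ih (f x) (by omega) (fun y h h' => hd y h (by omega))
      have hne : Nat.beq x 0 = false := by
        rw [← Bool.not_eq_true, Nat.beq_eq]; omega
      simp only [walk, Bool.or_eq_true, hne, Bool.false_eq_true, false_or, Bool.and_eq_true, this]
      constructor
      · rintro ⟨a, b⟩ k
        cases k with
        | zero => intro _; exact a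
        | succ k => exact b k
      · intro h
        exact ⟨h 0 (by simpa using hp.ne'), fun k => h (k+1)⟩

theorem q_congr (f g : ℕ → ℕ) (x v : ℕ) (h : f x = g x) (h' : f (x+1) = g (x+1)) :
    q f x v = q g x v := by simp [q, h, h']

theorem walk_congr (f g : ℕ → ℕ) (v n : ℕ) (h : ∀ y, y ≤ n → f y = g y)
    (hd : ∀ y, 0 < y → y ≤ n → g y < y) : ∀ fuel x, x < n →
    walk f v fuel x = walk g v fuel x := by
  intro fuel
  induction fuel with
  | zero => intros; rfl
  | succ m ih =>
    intro x hx
    rcases Nat.eq_zero_or_pos x with rfl | hp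
    · simp [walk]
    · have h1 := hd x hp hx.le
      simp only [walk, h x hx.le]
      rw [ih (g x) (by omega), q_congr f g x v (h x hx.le) (h _ hx)]

/-- step condition -/
def okP (τ : ℕ → ℕ) (n : ℕ) : Prop := τ (n+1) ≤ τ n + 1 ∧
  ∀ k, 0 < k → τ^[k] n ≠ 0 → q τ (τ^[k] n) (τ (n+1)) = true

theorem ok_iff (f τ : ℕ → ℕ) (n : ℕ) (hn : 1 ≤ n) (h0 : τ 0 = 0)
    (h : ∀ y, y ≤ n → f y = τ y)
    (hd : ∀ y, 0 < y → y ≤ n → τ y < y) : ok f n (τ (n+1)) = true ↔ okP τ n := by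
  have h1 := hd n hn le_rfl
  rw [ok, h n le_rfl, walk_congr f τ _ n h hd _ _ h1, Bool.and_eq_true, Nat.ble_eq,
    walk_iff τ _ h0 _ _ h1.le (fun y a b => hd y a (by omega)), okP]
  refine and_congr_right fun _ => ⟨fun H k hk => ?_, fun H k => H (k+1) (by omega)⟩
  obtain ⟨k, rfl⟩ : ∃ j, k = j + 1 := ⟨k-1, by omega⟩
  exact H k

theorem dec_of_B (N : ℕ) (τ : ℕ → ℕ) (h1 : τ 1 = 0) (hB : PropB N τ) :
    ∀ y, 0 < y → y ≤ N → τ y < y := by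
  intro y
  induction y with
  | zero => intro h; omega
  | succ n ih =>
    intro _ h
    rcases Nat.eq_zero_or_pos n with rfl | hp
    · simp [h1]
    · have := hB n hp h
      have := ih hp (by omega)
      omega

theorem orbit (τ : ℕ → ℕ) (N : ℕ) (hd : ∀ y, 0 < y → y ≤ N → τ y < y) (h0 : τ 0 = 0)
    (n : ℕ) (hn : n ≤ N) : ∀ k, τ^[k] n ≤ n - k := by
  intro k
  induction k with
  | zero => simp
  | succ k ih =>
    rw [Function.iterate_succ_apply']
    rcases Nat.eq_zero_or_pos (τ^[k] n) with h | h
    · rw [h, h0]; omega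
    · have := hd _ h (by omega)
      omega

theorem ord_spec (τ : ℕ → ℕ) (N : ℕ) (hd : ∀ y, 0 < y → y ≤ N → τ y < y) (h0 : τ 0 = 0)
    (n : ℕ) (hn : n ≤ N) (k : ℕ) : k < ordOf τ n ↔ τ^[k] n ≠ 0 := by
  have hne : {m | τ^[m] n = 0}.Nonempty := ⟨n, by
    have := orbit τ N hd h0 n hn n
    simp only [Set.mem_ofPred_eq]; omega⟩
  constructor
  · intro h hc; exact Nat.notMem_of_lt_sInf (s := {m | τ^[m] n = 0}) h hc
  · intro h
    by_contra hc
    apply h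
    have hm : τ^[ordOf τ n] n = 0 := Nat.sInf_mem hne
    obtain ⟨j, rfl⟩ : ∃ j, k = j + ordOf τ n := ⟨k - ordOf τ n, by omega⟩
    rw [Function.iterate_add_apply, hm]
    exact Function.iterate_fixed h0 j

theorem adm_iff (N : ℕ) (τ : ℕ → ℕ) : Admissible N τ ↔
    τ 0 = 0 ∧ τ 1 = 0 ∧ ∀ n, 1 ≤ n → n + 1 ≤ N → okP τ n := by
  unfold Admissible PropA
  refine and_congr_right fun h0 => and_congr_right fun h1 => ?_
  by_cases hB : PropB N τ
  swap
  · exact ⟨fun h => (hB h.1).elim, fun h => (hB fun n a b => (h n a b).1).elim⟩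
  have hd := dec_of_B N τ h1 hB
  have ho := ord_spec τ N hd h0
  have ho1 : ∀ m, 0 < m → m ≤ N → (ordOf τ m = 1 ↔ τ m = 0) := by
    intro m hm hN
    have a := ho m hN 0
    have b := ho m hN 1
    simp only [Function.iterate_zero, id, Function.iterate_one] at a b
    have : 0 < ordOf τ m := a.2 hm.ne'
    constructor
    · intro h; by_contra hc; have := b.2 hc; omega
    · intro h; by_contra hc; exact b.1 (by omega) h
  have hit : ∀ k n, τ^[k+1] n = τ (τ^[k] n) := fun k n => Function.iterate_succ_apply' τ k n
  constructor
  · rintro ⟨_, hC, hD, hE⟩ n hn hN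
    refine ⟨hB n hn hN, fun k hk hx => ?_⟩
    have hk' := (ho n (by omega) k).2 hx
    have c := hC n hn hN k hk hk'
    have d := hD n hn hN k hk hk'
    rw [hit] at c d
    refine (q_iff _ _ _).2 ⟨c, d, fun e1 e2 => ?_⟩
    have hk2 : ¬ (k + 1 < ordOf τ n) := by
      rw [ho n (by omega), hit]; simpa using e1
    have hkk : ordOf τ n - 1 = k := by omega
    apply hE n hn hN (by omega)
    rw [hkk]
    have := orbit τ N hd h0 n (by omega) k
    exact (ho1 _ (by omega) (by omega)).2 e2
  · intro H
    refine ⟨hB, ?_, ?_, ?_⟩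
    · intro n hn hN k hk hk'
      rw [hit]
      exact ((q_iff _ _ _).1 ((H n hn hN).2 k hk ((ho n (by omega) k).1 hk'))).1
    · intro n hn hN k hk hk'
      rw [hit]
      exact ((q_iff _ _ _).1 ((H n hn hN).2 k hk ((ho n (by omega) k).1 hk'))).2.1
    · intro n hn hN h1o ho2
      have hx := (ho n (by omega) (ordOf τ n - 1)).1 (by omega)
      have hor := orbit τ N hd h0 n (by omega) (ordOf τ n - 1)
      refine ((q_iff _ _ _).1 ((H n hn hN).2 _ (by omega) hx)).2.2 ?_ ?_
      · rw [← hit]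
        have := (ho n (by omega) (ordOf τ n - 1 + 1)).not.1 (by omega)
        simpa using this
      · exact (ho1 _ (by omega) (by omega)).1 ho2

theorem mem_gen (τ : ℕ → ℕ) : ∀ N, (List.range (N+2)).map τ ∈ gen N ↔ Admissible (N+1) τ := by
  intro N
  induction N with
  | zero =>
    rw [adm_iff]
    simp only [gen]
    simp [List.range_succ]
    intros
    omega
  | succ N ih =>
    have e : (List.range (N+1+2)).map τ = (List.range (N+2)).map τ ++ [τ (N+2)] := by
      rw [List.range_succ]; simp
    have key : Admissible (N+1) τ → (ok (look ((List.range (N+2)).map τ)) (N+1) (τ (N+2)) = true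
        ↔ okP τ (N+1)) := by
      intro h
      exact ok_iff _ τ (N+1) (by omega) h.1 (fun y hy => look_range τ _ _ (by omega))
        (dec_of_B _ _ h.2.1 h.2.2.1)
    have step : Admissible (N+1+1) τ ↔ Admissible (N+1) τ ∧ okP τ (N+1) := by
      rw [adm_iff, adm_iff]
      constructor
      · rintro ⟨a, b, c⟩
        exact ⟨⟨a, b, fun n h h' => c n h (by omega)⟩, c _ (by omega) le_rfl⟩
      · rintro ⟨⟨a, b, c⟩, d⟩
        refine ⟨a, b, fun n h h' => ?_⟩
        rcases Nat.lt_or_ge n (N+1) with h2 | h2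
        · exact c n h (by omega)
        · obtain rfl : n = N + 1 := by omega
          exact d
    rw [step, e]
    simp only [gen, List.mem_flatMap, List.mem_map, List.mem_filter, List.mem_range]
    constructor
    · rintro ⟨l, hl, v, ⟨_, hv⟩, hh⟩
      obtain ⟨rfl, h2⟩ := List.append_inj' hh rfl
      obtain rfl : v = τ (N+2) := by simpa using h2
      have := ih.1 hl
      exact ⟨this, (key this).1 hv⟩
    · rintro ⟨h, h'⟩
      refine ⟨_, ih.2 h, τ (N+2), ⟨?_, (key h).2 h'⟩, rfl⟩
      have a := h'.1
      have b := dec_of_B _ _ h.2.1 h.2.2.1 (N+1) (by omega) le_rfl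
      have : τ (N+1+1) = τ (N+2) := rfl
      omega

theorem gen_length (N : ℕ) : ∀ l ∈ gen N, l.length = N + 2 := by
  induction N with
  | zero => simp [gen]
  | succ N ih =>
    intro l hl
    simp only [gen, List.mem_flatMap, List.mem_map] at hl
    obtain ⟨l', h, v, _, rfl⟩ := hl
    simp [ih l' h]

theorem gen_nodup (N : ℕ) : (gen N).Nodup := by
  induction N with
  | zero => simp [gen]
  | succ N ih =>
    rw [gen, List.nodup_flatMap]
    constructor
    · intro l _
      refine List.Nodup.map ?_ (List.nodup_range.filter _)
      intro a b h
      simpa using h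
    · refine List.Pairwise.imp ?_ ih
      intro a b hab l h1 h2
      simp only [List.mem_map] at h1 h2
      obtain ⟨v, _, rfl⟩ := h1
      obtain ⟨w, _, hw⟩ := h2
      exact hab (List.append_inj' hw rfl).1.symm

theorem map_look (l : List ℕ) : (List.range l.length).map (look l) = l := by
  induction l with
  | nil => rfl
  | cons a l ih =>
    rw [List.length_cons, List.range_succ_eq_map, List.map_cons, List.map_map]
    congr 1

theorem look_ge : ∀ (l : List ℕ) (n : ℕ), l.length ≤ n → look l n = 0
  | [], _, _ => rfl
  | _ :: _, 0, h => by simp at h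
  | _ :: l, n+1, h => look_ge l n (by simpa using h)

theorem tail_congr (N : ℕ) (τ : ℕ → ℕ) (h : ∀ n, N < n → τ n = 0) :
    look ((List.range (N+1)).map τ) = τ := by
  funext n
  rcases Nat.lt_or_ge n (N+1) with h2 | h2
  · exact look_range _ _ _ h2
  · rw [look_ge _ _ (by simpa using h2), h n h2]

def eqv : {τ : ℕ → ℕ // TauFunction 11 τ} ≃ {l // l ∈ (gen 10).toFinset} where
  toFun τ := ⟨(List.range 12).map τ.1, List.mem_toFinset.2 ((mem_gen τ.1 10).2 τ.2.1)⟩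
  invFun l := ⟨look l.1, by
    have h := List.mem_toFinset.1 l.2
    have hl := gen_length 10 _ h
    refine ⟨(mem_gen _ 10).1 ?_, fun n hn => look_ge _ _ (by omega)⟩
    rw [← hl, map_look]; exact h⟩
  left_inv τ := Subtype.ext (tail_congr 11 τ.1 τ.2.2)
  right_inv l := Subtype.ext (by
    have hl := gen_length 10 _ (List.mem_toFinset.1 l.2)
    have := map_look l.1
    rw [hl] at this
    exact this)

end TauCount

/-- the number of admissible τ-functions of length 11 equals 1361. -/
theorem card_tau_length_11 :
    Nat.card {τ : ℕ → ℕ // TauFunction 11 τ} = 1361 := by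
  rw [Nat.card_congr TauCount.eqv, Nat.card_eq_fintype_card, Fintype.card_coe,
    List.toFinset_card_of_nodup (TauCount.gen_nodup 10), TauCount.gen_len]
end

section
/- The number of admissible τ-functions of length 12 equals 2895. -/
open Function

def tf (l : List ℕ) (i : ℕ) : ℕ := l.getD i 0

def walk (τ : ℕ → ℕ) (v : ℕ) : ℕ → ℕ → Bool
  | 0, _ => true
  | f+1, a => Nat.beq a 0 ||
      ((Nat.ble (a+1) v || (Nat.ble v (τ a + 1) &&
          (!(Nat.beq (τ (a+1)) (τ a + 1)) || Nat.ble v (τ a))))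
       && ((!(Nat.beq (τ a) 0)) || (!(Nat.beq (τ (a+1)) 0)) || (!(Nat.beq v 0)))
       && walk τ v f (τ a))

def LL : ℕ → List (List ℕ)
  | 0 => [[0,0]]
  | m+1 => (LL m).flatMap fun l =>
     ((List.range (tf l (m+1) + 2)).filter
       fun v => walk (tf l) v (m+1) (tf l (m+1))).map fun v => l ++ [v]

theorem LL_length : (LL 11).length = 2895 := by decide +kernel

/-- One-point condition. -/
def Pt (τ : ℕ → ℕ) (v a : ℕ) : Prop :=
  (v < a + 1 → v ≤ τ a + 1 ∧ (τ (a+1) = τ a + 1 → v < τ a + 1)) ∧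
  (τ a = 0 → τ (a+1) = 0 → v ≠ 0)

theorem iter_zero {τ : ℕ → ℕ} (h0 : τ 0 = 0) (k : ℕ) : τ^[k] 0 = 0 :=
  Function.iterate_fixed h0 k

theorem walk_succ (τ : ℕ → ℕ) (v f a : ℕ) :
    walk τ v (f+1) a = true ↔ (a ≠ 0 → Pt τ v a ∧ walk τ v f (τ a) = true) := by
  simp only [walk, Pt, Bool.or_eq_true, Bool.and_eq_true, Bool.not_eq_true', Nat.beq_eq,
    Nat.ble_eq, ← Bool.not_eq_true]
  by_cases ha : a = 0
  · simp [ha]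
  · simp only [ha, false_or, ne_eq, not_false_eq_true, true_imp_iff]
    refine and_congr (and_congr ?_ ?_) Iff.rfl
    · constructor
      · rintro h h1
        omega
      · intro h
        by_cases h1 : v < a + 1
        · have := h h1
          omega
        · omega
    · tauto

theorem walk_iff {τ : ℕ → ℕ} {n : ℕ} (v : ℕ) (h0 : τ 0 = 0)
    (hd : ∀ x, 0 < x → x ≤ n → τ x < x) :
    ∀ f a, a ≤ n → a ≤ f →
      (walk τ v f a = true ↔ ∀ k, τ^[k] a ≠ 0 → Pt τ v (τ^[k] a)) := by
  intro f
  induction f with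
  | zero =>
    intro a _ h
    obtain rfl : a = 0 := by omega
    simp [walk, iter_zero h0]
  | succ f ih =>
    intro a han haf
    rw [walk_succ]
    by_cases ha : a = 0
    · subst ha; simp [iter_zero h0]
    · have := hd a (by omega) han
      rw [ih (τ a) (by omega) (by omega)]
      constructor
      · intro h k
        obtain ⟨h1, h2⟩ := h ha
        cases k with
        | zero => intro _; exact h1
        | succ k => exact h2 k
      · intro h _
        exact ⟨h 0 ha, fun k => h (k+1)⟩

theorem walk_congr {τ σ : ℕ → ℕ} {n : ℕ} (v : ℕ)
    (hd : ∀ x, 0 < x → x ≤ n → τ x < x) (he : ∀ x, x ≤ n → τ x = σ x) :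
    ∀ f a, a < n → walk τ v f a = walk σ v f a := by
  intro f
  induction f with
  | zero => intro a _; rfl
  | succ f ih =>
    intro a ha
    by_cases h : a = 0
    · subst h; simp [walk]
    · have := hd a (by omega) (by omega)
      simp only [walk]
      rw [ih (τ a) (by omega), he a (by omega), he (a+1) (by omega)]

theorem ordOf_lt {τ : ℕ → ℕ} {n : ℕ} (h0 : τ 0 = 0)
    (hd : ∀ x, 0 < x → x ≤ n → τ x < x) :
    ∀ a, a ≤ n → τ^[ordOf τ a] a = 0 ∧ ∀ k, k < ordOf τ a ↔ τ^[k] a ≠ 0 := by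
  have ex : ∀ a, a ≤ n → ∃ m, τ^[m] a = 0 := by
    intro a
    induction a using Nat.strong_induction_on with
    | _ a ih =>
      intro han
      by_cases ha : a = 0
      · exact ⟨0, ha⟩
      · have := hd a (by omega) han
        obtain ⟨m, hm⟩ := ih (τ a) this (by omega)
        exact ⟨m+1, hm⟩
  intro a han
  have hz : τ^[ordOf τ a] a = 0 := Nat.sInf_mem (s := {m | τ^[m] a = 0}) (ex a han)
  refine ⟨hz, fun k => ⟨fun h => Nat.notMem_of_lt_sInf (s := {m | τ^[m] a = 0}) h, fun h => ?_⟩⟩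
  by_contra hk
  apply h
  obtain ⟨d, rfl⟩ := Nat.exists_eq_add_of_le (not_lt.mp hk)
  rw [add_comm, Function.iterate_add_apply, hz, iter_zero h0]

/-- Step condition. -/
def Step (τ : ℕ → ℕ) (n : ℕ) : Prop :=
  τ (n+1) ≤ τ n + 1 ∧ walk τ (τ (n+1)) n (τ n) = true

theorem dec_of {τ : ℕ → ℕ} {N : ℕ} (h1 : τ 1 = 0)
    (hB : ∀ n, 1 ≤ n → n + 1 ≤ N → τ (n + 1) ≤ τ n + 1) :
    ∀ x, 0 < x → x ≤ N → τ x < x := by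
  intro x hx
  induction x, hx using Nat.le_induction with
  | base => intro _; show τ 1 < 1; omega
  | succ x hx ih =>
    intro h
    have := ih (by omega)
    have := hB x hx h
    omega

theorem step_iff {τ : ℕ → ℕ} {N n : ℕ} (h0 : τ 0 = 0) (hn : 1 ≤ n) (hnN : n + 1 ≤ N)
    (hd : ∀ x, 0 < x → x ≤ N → τ x < x) :
    walk τ (τ (n+1)) n (τ n) = true ↔
    (∀ k, 0 < k → k < ordOf τ n →
      τ (n + 1) < τ^[k] n + 1 → τ (n + 1) ≤ τ^[k + 1] n + 1) ∧
    (∀ k, 0 < k → k < ordOf τ n →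
      τ (n + 1) < τ^[k] n + 1 → τ (τ^[k] n + 1) = τ^[k + 1] n + 1 →
      τ (n + 1) < τ^[k + 1] n + 1) ∧
    (1 < ordOf τ n →
      ordOf τ (τ^[ordOf τ n - 1] n + 1) = 1 → τ (n + 1) ≠ 0) := by
  have hdn := hd n (by omega) (by omega)
  rw [walk_iff (n := N) _ h0 hd n (τ n) (by omega) (by omega)]
  obtain ⟨hz, ho⟩ := ordOf_lt h0 hd n (by omega)
  have hle : ∀ k, τ^[k] n ≤ n := by
    intro k
    induction k with
    | zero => simp
    | succ k ih =>
      rw [Function.iterate_succ_apply']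
      rcases Nat.eq_zero_or_pos (τ^[k] n) with h | h
      · rw [h, h0]; omega
      · have := hd _ h (by omega)
        omega
  have ho1 : ∀ a, a ≤ n → (ordOf τ (a+1) = 1 ↔ τ (a+1) = 0) := by
    intro a ha
    obtain ⟨hz', ho'⟩ := ordOf_lt h0 hd (a+1) (by omega)
    have e0 := ho' 0
    have e1 := ho' 1
    simp only [Function.iterate_zero, id, Function.iterate_one] at e0 e1
    omega
  have key : ∀ k, τ^[k] (τ n) = τ^[k+1] n := fun k => rfl
  simp only [key, Pt, ← Function.iterate_succ_apply' τ]
  constructor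
  · intro h
    refine ⟨?_, ?_, ?_⟩
    · intro k hk hko hlt
      obtain ⟨k, rfl⟩ : ∃ j, k = j + 1 := ⟨k - 1, by omega⟩
      exact ((h k ((ho _).1 hko)).1 hlt).1
    · intro k hk hko hlt
      obtain ⟨k, rfl⟩ : ∃ j, k = j + 1 := ⟨k - 1, by omega⟩
      exact ((h k ((ho _).1 hko)).1 hlt).2
    · intro h1 h2
      obtain ⟨j, hj⟩ : ∃ j, ordOf τ n = j + 2 := ⟨ordOf τ n - 2, by omega⟩
      rw [ho1 _ (hle _)] at h2
      rw [hj] at h2 hz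
      exact (h j ((ho _).1 (by omega))).2 hz h2
  · rintro ⟨hC, hD, hE⟩ k hk
    have hko := (ho _).2 hk
    refine ⟨fun hlt => ⟨hC (k+1) (by omega) hko hlt, hD (k+1) (by omega) hko hlt⟩, ?_⟩
    intro hb h2
    have : ordOf τ n = k + 2 := by
      have := (ho (k+2)).not
      simp only [not_lt, not_not] at this
      have := this.2 hb
      omega
    apply hE (by omega)
    rw [ho1 _ (hle _), this]
    exact h2

theorem tau_iff (N : ℕ) (τ : ℕ → ℕ) : TauFunction N τ ↔
    (τ 0 = 0 ∧ τ 1 = 0 ∧ (∀ n, 1 ≤ n → n + 1 ≤ N → Step τ n)) ∧ ∀ n, N < n → τ n = 0 := by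
  unfold TauFunction Admissible PropA PropB PropC PropD PropE Step
  refine and_congr_left fun _ => and_congr_right fun h0 => and_congr_right fun h1 => ?_
  constructor
  · rintro ⟨hB, hC, hD, hE⟩ n hn hnN
    exact ⟨hB n hn hnN, (step_iff h0 hn hnN (dec_of h1 hB)).2
      ⟨hC n hn hnN, hD n hn hnN, hE n hn hnN⟩⟩
  · intro h
    have hB : ∀ n, 1 ≤ n → n + 1 ≤ N → τ (n + 1) ≤ τ n + 1 := fun n a b => (h n a b).1
    have hs := fun n a b => (step_iff h0 a b (dec_of h1 hB)).1 (h n a b).2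
    exact ⟨hB, fun n a b => (hs n a b).1, fun n a b => (hs n a b).2.1,
      fun n a b => (hs n a b).2.2⟩

theorem tf_append_lt (l : List ℕ) (v x : ℕ) (h : x < l.length) : tf (l ++ [v]) x = tf l x := by
  simp [tf, List.getD_eq_getElem?_getD, List.getElem?_append_left h]

theorem tf_append_eq (l : List ℕ) (v : ℕ) : tf (l ++ [v]) l.length = v := by
  simp [tf]

theorem tf_ge (l : List ℕ) (x : ℕ) (h : l.length ≤ x) : tf l x = 0 := by
  simp [tf, List.getElem?_eq_none h]

/-- Admissibility in terms of steps. -/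
def Adm (N : ℕ) (τ : ℕ → ℕ) : Prop :=
  τ 0 = 0 ∧ τ 1 = 0 ∧ (∀ n, 1 ≤ n → n + 1 ≤ N → Step τ n)

theorem Adm.dec {N : ℕ} {τ : ℕ → ℕ} (h : Adm N τ) : ∀ x, 0 < x → x ≤ N → τ x < x :=
  dec_of h.2.1 fun n a b => (h.2.2 n a b).1

theorem Adm.congr {N : ℕ} {τ σ : ℕ → ℕ} (hN : 1 ≤ N) (h : Adm N τ)
    (he : ∀ x, x ≤ N → τ x = σ x) : Adm N σ := by
  refine ⟨he 0 (by omega) ▸ h.1, he 1 hN ▸ h.2.1, fun n a b => ?_⟩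
  have hs := h.2.2 n a b
  have hd := h.dec n (by omega) (by omega)
  unfold Step at hs ⊢
  rw [← he n (by omega), ← he (n+1) b, ← walk_congr (n := N) _ h.dec he _ _ (by omega)]
  exact hs

theorem mem_LL (m : ℕ) : ∀ l, l ∈ LL m ↔ l.length = m + 2 ∧ Adm (m+1) (tf l) := by
  induction m with
  | zero =>
    intro l
    simp only [LL, List.mem_singleton]
    constructor
    · rintro rfl
      exact ⟨rfl, rfl, rfl, fun n a b => by omega⟩
    · rintro ⟨hl, h0, h1, -⟩
      match l, hl with
      | [a, b], _ =>
        simp [tf] at h0 h1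
        simp [h0, h1]
  | succ m ih =>
    intro l'
    simp only [LL, List.mem_flatMap, List.mem_map, List.mem_filter, List.mem_range]
    constructor
    · rintro ⟨l, hl, v, ⟨hv, hw⟩, rfl⟩
      obtain ⟨hlen, hA⟩ := (ih l).1 hl
      have he : ∀ x, x ≤ m + 1 → tf l x = tf (l ++ [v]) x := fun x hx =>
        (tf_append_lt l v x (by omega)).symm
      have hA' := hA.congr (by omega) he
      have hvv : tf (l ++ [v]) (m + 1 + 1) = v := by
        have := tf_append_eq l v
        rwa [hlen] at this
      refine ⟨by simp [hlen], hA'.1, hA'.2.1, fun n a b => ?_⟩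
      by_cases hn : n = m + 1
      · subst hn
        have hd := hA.dec (m+1) (by omega) (by omega)
        unfold Step
        rw [hvv, ← he _ le_rfl, ← walk_congr (n := m+1) _ hA.dec he _ _ (by omega)]
        exact ⟨by omega, hw⟩
      · exact hA'.2.2 n a (by omega)
    · rintro ⟨hlen, hA⟩
      obtain ⟨l, v, rfl⟩ : ∃ l v, l' = l ++ [v] := by
        rcases List.eq_nil_or_concat l' with h | ⟨l, v, h⟩
        · simp [h] at hlen
        · exact ⟨l, v, by simpa using h⟩
      have hlen' : l.length = m + 2 := by simpa using hlen
      have he : ∀ x, x ≤ m + 1 → tf (l ++ [v]) x = tf l x := fun x hx =>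
        tf_append_lt l v x (by omega)
      have hA0 : Adm (m+1) (tf (l ++ [v])) :=
        ⟨hA.1, hA.2.1, fun n a b => hA.2.2 n a (by omega)⟩
      have hA' : Adm (m+1) (tf l) := hA0.congr (by omega) he
      have hvv : tf (l ++ [v]) (m + 1 + 1) = v := by
        have := tf_append_eq l v
        rwa [hlen'] at this
      have hs := hA.2.2 (m+1) (by omega) (by omega)
      have hd := hA0.dec (m+1) (by omega) (by omega)
      unfold Step at hs
      rw [hvv, walk_congr (n := m+1) _ hA0.dec he _ _ (by omega), he _ le_rfl] at hs
      exact ⟨l, (ih l).2 ⟨hlen', hA'⟩, v, ⟨by omega, hs.2⟩, rfl⟩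

theorem nodup_LL (m : ℕ) : (LL m).Nodup := by
  induction m with
  | zero => simp [LL]
  | succ m ih =>
    simp only [LL]
    rw [List.nodup_flatMap]
    refine ⟨fun l _ => ?_, ih.imp fun {l l'} hne => ?_⟩
    · exact (List.nodup_range.filter _).map fun a b h => by simpa using h
    · intro x hx hx'
      simp only [List.mem_map] at hx hx'
      obtain ⟨v, -, rfl⟩ := hx
      obtain ⟨w, -, h⟩ := hx'
      exact hne (List.append_inj_left' h rfl).symm

theorem tf_inj {l l' : List ℕ} (hl : l.length = l'.length) (h : tf l = tf l') : l = l' := by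
  apply List.ext_getElem hl
  intro i h1 h2
  have := congrFun h i
  simpa [tf, h1, h2] using this

theorem tau_iff_mem (τ : ℕ → ℕ) :
    TauFunction 12 τ ↔ ∃ l ∈ LL 11, tf l = τ := by
  rw [tau_iff]
  constructor
  · rintro ⟨hA, hz⟩
    have e : tf ((List.range 13).map τ) = τ := by
      funext x
      by_cases hx : x < 13
      · simp [tf, hx]
      · rw [tf_ge _ _ (by simp; omega), hz x (by omega)]
    refine ⟨(List.range 13).map τ, (mem_LL 11 _).2 ⟨by simp, ?_⟩, e⟩
    rw [e]; exact hA
  · rintro ⟨l, hl, rfl⟩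
    obtain ⟨h1, h2⟩ := (mem_LL 11 l).1 hl
    exact ⟨h2, fun n hn => tf_ge _ _ (by omega)⟩

/-- the number of admissible τ-functions of length 12 equals 2895. -/
theorem card_tau_length_12 :
    Nat.card {τ : ℕ → ℕ // TauFunction 12 τ} = 2895 := by
  classical
  have hset : {τ : ℕ → ℕ | TauFunction 12 τ} = ((LL 11).toFinset.image tf : Finset (ℕ → ℕ)) := by
    ext τ
    simp [tau_iff_mem]
  have h1 : Nat.card {τ : ℕ → ℕ // TauFunction 12 τ} = Set.ncard {τ : ℕ → ℕ | TauFunction 12 τ} :=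
    rfl
  rw [h1, hset, Set.ncard_coe_finset, Finset.card_image_of_injOn,
    List.toFinset_card_of_nodup (nodup_LL 11), LL_length]
  intro l hl l' hl' h
  have a := ((mem_LL 11 l).1 (by simpa using hl)).1
  have b := ((mem_LL 11 l').1 (by simpa using hl')).1
  exact tf_inj (a.trans b.symm) h
end
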